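/- Let l > 0. For every Schwartz function φ on ℝ^4 the triple integral below is absolutely convergent and − ∫_{ℝ^4}∫_{ℝ^4}∫_{ℝ^4} |x|^{−4}|y|^{−4}|z|^{−4} log(|x|/l) log(|y|/l) log(|z|/l) Σ_{i,j,k=1}^{4} x_i y_j z_k (∂_i ∂_j ∂_k φ)(x+y+z) dx dy dz = −4π⁴ ∫_{ℝ^4} |w|^{−4} (log(|w|/l))³ (w·∇φ(w)) dw + 3π⁴ ∫_{ℝ^4} |w|^{−4} log(|w|/l) (w·∇φ(w)) dw + (4ζ(3) − 2) π⁶ φ(0), where ζ is the Riemann zeta function. (This is the renormalized trikini (three-bubble chain) amplitude: (R_4[r^{−4}])^{*3} = 12π⁴ R_4[r^{−4} log²(r/l)] − 3π⁴ R_4[r^{−4}] + (4ζ(3)−2)π⁶ δ.) -/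

import Mathlib

open MeasureTheory Real SchwartzMap

noncomputable section

/-- `ζ(3) = Σ_{n≥1} 1/n³`, the value of the Riemann zeta function at `3`. -/
def zeta3 : ℝ := ∑' n : ℕ, 1 / ((n : ℝ) + 1) ^ 3

/-- Third partial derivative `∂_i ∂_j ∂_k f` at a point, in directions `u, v, w`. -/
def thirdDeriv (f : EuclideanSpace ℝ (Fin 4) → ℝ)
    (p u v w : EuclideanSpace ℝ (Fin 4)) : ℝ :=
  fderiv ℝ (fun z => fderiv ℝ (fun y => fderiv ℝ f y w) z v) p u

/-- Euclidean four-space. -/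
abbrev E4 := EuclideanSpace ℝ (Fin 4)

/-- Heat kernel on `E4` (variance normalised so that `hk a * hk b = hk (a+b)`). -/
def hk (a : ℝ) (x : E4) : ℝ := ((π * a) ^ 2)⁻¹ * Real.exp (-(‖x‖ ^ 2 / a))

lemma hk_nonneg (a : ℝ) (x : E4) : 0 ≤ hk a x := by unfold hk; positivity

lemma hk_meas : Measurable (fun p : ℝ × E4 => hk p.1 p.2) := by
  unfold hk; fun_prop

lemma gauss_int {b : ℝ} (hb : 0 < b) : ∫ v : E4, Real.exp (-b * ‖v‖ ^ 2) = (π / b) ^ 2 := by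
  rw [GaussianFourier.integral_rexp_neg_mul_sq_norm hb]
  simp only [finrank_euclideanSpace, Fintype.card_fin]
  rw [← Real.rpow_natCast]; norm_num

lemma heat_conv {a b : ℝ} (ha : 0 < a) (hb : 0 < b) (w : E4) :
    ∫⁻ x, ENNReal.ofReal (hk a x) * ENNReal.ofReal (hk b (w - x))
      = ENNReal.ofReal (hk (a + b) w) := by
  have hab : 0 < a + b := by positivity
  have key : ∀ x : E4, hk a x * hk b (w - x) =
      (((π * a) ^ 2)⁻¹ * ((π * b) ^ 2)⁻¹ * Real.exp (-(‖w‖ ^ 2 / (a + b)))) *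
        Real.exp (-((a + b) / (a * b)) * ‖x - (a / (a + b)) • w‖ ^ 2) := by
    intro x
    unfold hk
    have h1 : ‖x‖ ^ 2 / a + ‖w - x‖ ^ 2 / b = ‖w‖ ^ 2 / (a + b) +
        ((a + b) / (a * b)) * ‖x - (a / (a + b)) • w‖ ^ 2 := by
      rw [norm_sub_sq_real, norm_sub_sq_real, inner_smul_right, norm_smul, real_inner_comm]
      rw [Real.norm_of_nonneg (by positivity)]
      field_simp
      ring
    rw [mul_mul_mul_comm, ← Real.exp_add, mul_assoc _ (Real.exp _), ← Real.exp_add]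
    congr 2
    linarith
  have hval : ∫ x, hk a x * hk b (w - x) = hk (a + b) w := by
    simp_rw [key]
    rw [integral_const_mul,
      integral_sub_right_eq_self (fun x : E4 => Real.exp (-((a + b) / (a * b)) * ‖x‖ ^ 2)),
      gauss_int (by positivity)]
    unfold hk
    field_simp
  have hpos : 0 < hk (a + b) w := by unfold hk; positivity
  have hint : Integrable (fun x => hk a x * hk b (w - x)) :=
    Integrable.of_integral_ne_zero (by rw [hval]; exact hpos.ne')
  rw [← hval, ofReal_integral_eq_lintegral_ofReal hint
    (Filter.Eventually.of_forall fun x => mul_nonneg (hk_nonneg _ _) (hk_nonneg _ _))]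
  simp_rw [ENNReal.ofReal_mul (hk_nonneg _ _)]

lemma riesz_rep {s : ℝ} (hs4 : s < 4) {x : E4} (hx : x ≠ 0) :
    ∫⁻ a in Set.Ioi (0 : ℝ), ENNReal.ofReal (a ^ (s / 2 - 1)) * ENNReal.ofReal (hk a x)
      = ENNReal.ofReal ((π ^ 2)⁻¹ * Real.Gamma (2 - s / 2) * ‖x‖ ^ (s - 4)) := by
  have hr : 0 < ‖x‖ := norm_pos_iff.mpr hx
  have hval : ∫ a in Set.Ioi (0 : ℝ), a ^ (s / 2 - 1) * hk a x
      = (π ^ 2)⁻¹ * Real.Gamma (2 - s / 2) * ‖x‖ ^ (s - 4) := by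
    have h1 := Real.integral_rpow_mul_exp_neg_mul_Ioi (a := 2 - s / 2) (r := ‖x‖ ^ 2)
      (by linarith) (by positivity)
    rw [← integral_comp_rpow_Ioi _ (show (-1 : ℝ) ≠ 0 by norm_num)] at h1
    have h2 : ∫ a in Set.Ioi (0 : ℝ), a ^ (s / 2 - 1) * hk a x =
        ∫ a in Set.Ioi (0 : ℝ), (π ^ 2)⁻¹ * ((|(-1 : ℝ)| * a ^ ((-1 : ℝ) - 1)) •
          ((a ^ (-1 : ℝ)) ^ (2 - s / 2 - 1) * Real.exp (-(‖x‖ ^ 2 * a ^ (-1 : ℝ))))) := by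
      refine setIntegral_congr_fun measurableSet_Ioi fun a ha => ?_
      have ha : 0 < a := ha
      simp only [smul_eq_mul, abs_neg, abs_one, one_mul]
      unfold hk
      rw [← Real.rpow_mul ha.le, Real.rpow_neg_one, mul_pow, mul_inv, div_eq_mul_inv (‖x‖ ^ 2) a]
      have : a ^ (s / 2 - 1) * (a ^ 2)⁻¹ = a ^ ((-1 : ℝ) - 1) * a ^ ((-1 : ℝ) * (2 - s / 2 - 1)) := by
        rw [← Real.rpow_natCast a 2, ← Real.rpow_neg ha.le, ← Real.rpow_add ha,
          ← Real.rpow_add ha]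
        congr 1; push_cast; ring
      linear_combination (π ^ 2)⁻¹ * Real.exp (-(‖x‖ ^ 2 * a⁻¹)) * this
    rw [h2, integral_const_mul, h1, mul_assoc, mul_comm (Real.Gamma _)]
    congr 2
    rw [one_div, Real.inv_rpow (by positivity), ← Real.rpow_neg (by positivity),
      ← Real.rpow_natCast, ← Real.rpow_mul hr.le]
    congr 1; push_cast; ring
  have hpos : 0 < (π ^ 2)⁻¹ * Real.Gamma (2 - s / 2) * ‖x‖ ^ (s - 4) := by
    have := Real.Gamma_pos_of_pos (show 0 < 2 - s / 2 by linarith)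
    positivity
  have hint : IntegrableOn (fun a => a ^ (s / 2 - 1) * hk a x) (Set.Ioi (0 : ℝ)) :=
    Integrable.of_integral_ne_zero (by rw [hval]; exact hpos.ne')
  rw [← hval, ofReal_integral_eq_lintegral_ofReal hint]
  · refine setLIntegral_congr_fun measurableSet_Ioi fun a ha => ?_
    have ha : 0 < a := ha
    rw [ENNReal.ofReal_mul (by positivity)]
  · refine ae_restrict_of_forall_mem measurableSet_Ioi fun a ha => ?_
    have ha : 0 < a := ha
    exact mul_nonneg (by positivity) (hk_nonneg _ _)

lemma beta_inner {p q A : ℝ} (hp : 0 < p) (hq : 0 < q) (hA : 0 < A) :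
    ∫⁻ a in Set.Ioo 0 A, ENNReal.ofReal (a ^ (p - 1)) * ENNReal.ofReal ((A - a) ^ (q - 1))
      = ENNReal.ofReal (Real.Gamma p * Real.Gamma q / Real.Gamma (p + q))
        * ENNReal.ofReal (A ^ (p + q - 1)) := by
  have hval : ∫ a in Set.Ioo 0 A, a ^ (p - 1) * (A - a) ^ (q - 1)
      = Real.Gamma p * Real.Gamma q / Real.Gamma (p + q) * A ^ (p + q - 1) := by
    have h1 := Complex.betaIntegral_scaled p q hA
    have h2 : ∫ x in (0:ℝ)..A, (x : ℂ) ^ ((p : ℂ) - 1) * ((A : ℂ) - x) ^ ((q : ℂ) - 1) =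
        ((∫ x in (0:ℝ)..A, x ^ (p - 1) * (A - x) ^ (q - 1) : ℝ) : ℂ) := by
      rw [← intervalIntegral.integral_ofReal]
      refine intervalIntegral.integral_congr fun x hx => ?_
      rw [Set.uIcc_of_le hA.le] at hx
      push_cast
      rw [Complex.ofReal_cpow hx.1, Complex.ofReal_cpow (by linarith [hx.2])]
      push_cast; rfl
    have h3 : Complex.betaIntegral p q =
        ((Real.Gamma p * Real.Gamma q / Real.Gamma (p + q) : ℝ) : ℂ) := by
      have := Complex.Gamma_mul_Gamma_eq_betaIntegral (s := p) (t := q) (by simpa) (by simpa)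
      rw [← Complex.ofReal_add, Complex.Gamma_ofReal, Complex.Gamma_ofReal,
        Complex.Gamma_ofReal] at this
      have hne : ((Real.Gamma (p + q) : ℝ) : ℂ) ≠ 0 := by
        exact_mod_cast (Real.Gamma_pos_of_pos (by positivity)).ne'
      push_cast
      rw [this]; field_simp
    rw [h2, h3] at h1
    rw [← integral_Ioc_eq_integral_Ioo, ← intervalIntegral.integral_of_le hA.le]
    have h4 : ((A : ℂ) ^ ((p : ℂ) + q - 1)) = ((A ^ (p + q - 1) : ℝ) : ℂ) := by
      rw [Complex.ofReal_cpow hA.le]; push_cast; rfl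
    rw [h4] at h1
    rw [mul_comm]
    exact_mod_cast h1
  have hB : 0 < Real.Gamma p * Real.Gamma q / Real.Gamma (p + q) := by
    have := Real.Gamma_pos_of_pos hp
    have := Real.Gamma_pos_of_pos hq
    have := Real.Gamma_pos_of_pos (add_pos hp hq)
    positivity
  have hpos : 0 < Real.Gamma p * Real.Gamma q / Real.Gamma (p + q) * A ^ (p + q - 1) := by
    positivity
  have hint : IntegrableOn (fun a => a ^ (p - 1) * (A - a) ^ (q - 1)) (Set.Ioo 0 A) :=
    Integrable.of_integral_ne_zero (by rw [hval]; exact hpos.ne')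
  rw [← ENNReal.ofReal_mul hB.le, ← hval, ofReal_integral_eq_lintegral_ofReal hint]
  · refine setLIntegral_congr_fun measurableSet_Ioo fun a ha => ?_
    have ha' : 0 < a := ha.1
    rw [ENNReal.ofReal_mul (by positivity)]
  · refine ae_restrict_of_forall_mem measurableSet_Ioo fun a ha => ?_
    have ha' : 0 < a := ha.1
    have ha'' : 0 < A - a := by linarith [ha.2]
    simp only [Pi.zero_apply]
    positivity

lemma beta_lint {p q : ℝ} (hp : 0 < p) (hq : 0 < q) {G : ℝ → ENNReal} (hG : Measurable G) :
    ∫⁻ a in Set.Ioi (0 : ℝ), ∫⁻ b in Set.Ioi (0 : ℝ),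
        ENNReal.ofReal (a ^ (p - 1)) * ENNReal.ofReal (b ^ (q - 1)) * G (a + b)
      = ENNReal.ofReal (Real.Gamma p * Real.Gamma q / Real.Gamma (p + q)) *
        ∫⁻ A in Set.Ioi (0 : ℝ), ENNReal.ofReal (A ^ (p + q - 1)) * G A := by
  have h1 : ∀ a : ℝ, ∫⁻ b in Set.Ioi (0 : ℝ),
        ENNReal.ofReal (a ^ (p - 1)) * ENNReal.ofReal (b ^ (q - 1)) * G (a + b)
      = ∫⁻ A, (Set.Ioi (0 : ℝ)).indicator
        (fun b => ENNReal.ofReal (a ^ (p - 1)) * ENNReal.ofReal (b ^ (q - 1)) * G (a + b))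
          (A - a) := by
    intro a
    rw [lintegral_sub_right_eq_self (fun b => (Set.Ioi (0 : ℝ)).indicator
        (fun b => ENNReal.ofReal (a ^ (p - 1)) * ENNReal.ofReal (b ^ (q - 1)) * G (a + b)) b),
      lintegral_indicator measurableSet_Ioi]
  simp_rw [h1]
  rw [lintegral_lintegral_swap]
  · rw [← lintegral_const_mul _ (by fun_prop), ← lintegral_indicator measurableSet_Ioi]
    refine lintegral_congr fun A => ?_
    by_cases hA : 0 < A
    · rw [Set.indicator_of_mem (show A ∈ Set.Ioi 0 from hA), ← mul_assoc, ← beta_inner hp hq hA,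
        ← lintegral_mul_const _ (by fun_prop), ← lintegral_indicator measurableSet_Ioi,
        ← lintegral_indicator measurableSet_Ioo]
      refine lintegral_congr fun a => ?_
      by_cases h0 : 0 < a <;> by_cases h2 : a < A <;>
        simp [Set.indicator, h0, h2]
    · rw [Set.indicator_of_notMem (show A ∉ Set.Ioi 0 from hA)]
      rw [setLIntegral_congr_fun (g := fun _ => 0) measurableSet_Ioi]
      · simp
      · intro a ha
        have ha : 0 < a := ha
        have : ¬ (a < A) := by linarith
        simp [Set.indicator, this]
  · apply Measurable.aemeasurable
    have : Function.uncurry (fun a A => (Set.Ioi (0 : ℝ)).indicator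
        (fun b => ENNReal.ofReal (a ^ (p - 1)) * ENNReal.ofReal (b ^ (q - 1)) * G (a + b))
          (A - a)) = ((fun z : ℝ × ℝ => z.2 - z.1) ⁻¹' (Set.Ioi (0 : ℝ))).indicator
        (fun z : ℝ × ℝ => ENNReal.ofReal (z.1 ^ (p - 1)) * ENNReal.ofReal ((z.2 - z.1) ^ (q - 1))
          * G (z.1 + (z.2 - z.1))) := by
      ext z
      rcases z with ⟨a, A⟩
      simp [Set.indicator, Function.uncurry]
    rw [this]
    refine Measurable.indicator (by fun_prop) ?_
    exact (measurableSet_Ioi).preimage (by fun_prop)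

/-- The Riesz kernel `|x|^{s-4}` with values in `ENNReal`. -/
def rk (s : ℝ) (x : E4) : ENNReal := ENNReal.ofReal (‖x‖ ^ (s - 4))

lemma rk_meas (s : ℝ) : Measurable (rk s) := by unfold rk; fun_prop

/-- The constant of the composition law of two Riesz kernels. -/
def C2 (s t : ℝ) : ℝ :=
  π ^ 2 * (Real.Gamma (s / 2) * Real.Gamma (t / 2) / Real.Gamma (s / 2 + t / 2)) *
    Real.Gamma (2 - (s + t) / 2) / (Real.Gamma (2 - s / 2) * Real.Gamma (2 - t / 2))

lemma C2_pos {s t : ℝ} (hs : 0 < s) (ht : 0 < t) (hst : s + t < 4) : 0 < C2 s t := by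
  unfold C2
  have := Real.Gamma_pos_of_pos (show 0 < s / 2 by linarith)
  have := Real.Gamma_pos_of_pos (show 0 < t / 2 by linarith)
  have := Real.Gamma_pos_of_pos (show 0 < s / 2 + t / 2 by linarith)
  have := Real.Gamma_pos_of_pos (show 0 < 2 - (s + t) / 2 by linarith)
  have := Real.Gamma_pos_of_pos (show 0 < 2 - s / 2 by linarith)
  have := Real.Gamma_pos_of_pos (show 0 < 2 - t / 2 by linarith)
  positivity

lemma ae_ne_zero : ∀ᵐ x : E4, x ≠ 0 := by
  have : (volume : Measure E4) {0} = 0 := measure_singleton 0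
  exact (measure_eq_zero_iff_ae_notMem.mp this).mono fun x hx => by simpa using hx

lemma ae_ne (w : E4) : ∀ᵐ x : E4, x ≠ w := by
  have : (volume : Measure E4) {w} = 0 := measure_singleton w
  exact (measure_eq_zero_iff_ae_notMem.mp this).mono fun x hx => by simpa using hx

/-- Composition of the Riesz kernels, pointwise. -/
lemma riesz_pt {s t : ℝ} (hs : 0 < s) (ht : 0 < t) (hst : s + t < 4) {w : E4} (hw : w ≠ 0) :
    ∫⁻ x, rk s x * rk t (w - x) = ENNReal.ofReal (C2 s t) * rk (s + t) w := by
  have g1 := Real.Gamma_pos_of_pos (show 0 < s / 2 by linarith)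
  have g2 := Real.Gamma_pos_of_pos (show 0 < t / 2 by linarith)
  have g3 := Real.Gamma_pos_of_pos (show 0 < s / 2 + t / 2 by linarith)
  have g4 := Real.Gamma_pos_of_pos (show 0 < 2 - (s + t) / 2 by linarith)
  have g5 := Real.Gamma_pos_of_pos (show 0 < 2 - s / 2 by linarith)
  have g6 := Real.Gamma_pos_of_pos (show 0 < 2 - t / 2 by linarith)
  set f : ℝ → ℝ → E4 → ENNReal := fun s a x =>
    ENNReal.ofReal (a ^ (s / 2 - 1)) * ENNReal.ofReal (hk a x) with hf
  have hfm : ∀ s, Measurable (fun z : ℝ × E4 => f s z.1 z.2) := by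
    intro s
    have := hk_meas
    simp only [hf]
    fun_prop
  have hrep : ∀ s < 4, ∀ x : E4, x ≠ 0 → ∫⁻ a in Set.Ioi (0:ℝ), f s a x =
      ENNReal.ofReal ((π ^ 2)⁻¹ * Real.Gamma (2 - s / 2)) * rk s x := by
    intro s hs x hx
    rw [hf, riesz_rep hs hx, rk, ← ENNReal.ofReal_mul]
    have g5 := Real.Gamma_pos_of_pos (show 0 < 2 - s / 2 by linarith)
    positivity
  have main : ∫⁻ x, (∫⁻ a in Set.Ioi (0:ℝ), f s a x) * (∫⁻ b in Set.Ioi (0:ℝ), f t b (w - x))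
      = ENNReal.ofReal (Real.Gamma (s / 2) * Real.Gamma (t / 2) / Real.Gamma (s / 2 + t / 2)) *
        (ENNReal.ofReal ((π ^ 2)⁻¹ * Real.Gamma (2 - (s + t) / 2)) * rk (s + t) w) := by
    rw [← hrep _ hst w hw]
    have e1 : ∀ x, (∫⁻ a in Set.Ioi (0:ℝ), f s a x) * (∫⁻ b in Set.Ioi (0:ℝ), f t b (w - x)) =
        ∫⁻ a in Set.Ioi (0:ℝ), ∫⁻ b in Set.Ioi (0:ℝ), f s a x * f t b (w - x) := by
      intro x
      rw [← lintegral_mul_const _ (by have := hfm s; fun_prop)]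
      refine lintegral_congr fun a => ?_
      rw [lintegral_const_mul _ (by have := hfm t; fun_prop)]
    have hF : Measurable (fun z : (E4 × ℝ) × ℝ => f s z.1.2 z.1.1 * f t z.2 (w - z.1.1)) := by
      have h1 := hfm s
      have h2 := hfm t
      fun_prop
    simp_rw [e1]
    rw [lintegral_lintegral_swap (by
      exact (hF.lintegral_prod_right' (ν := volume.restrict (Set.Ioi (0:ℝ)))).aemeasurable)]
    have e2 : ∀ a ∈ Set.Ioi (0:ℝ), ∫⁻ x, ∫⁻ b in Set.Ioi (0:ℝ), f s a x * f t b (w - x) =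
        ∫⁻ b in Set.Ioi (0:ℝ), ENNReal.ofReal (a ^ (s / 2 - 1)) * ENNReal.ofReal (b ^ (t / 2 - 1))
          * ENNReal.ofReal (hk (a + b) w) := by
      intro a ha
      rw [lintegral_lintegral_swap (by
        have h1 := hfm s
        have h2 := hfm t
        apply Measurable.aemeasurable
        unfold Function.uncurry
        fun_prop)]
      refine setLIntegral_congr_fun measurableSet_Ioi fun b hb => ?_
      rw [← heat_conv ha hb w, ← lintegral_const_mul]
      · refine lintegral_congr fun x => ?_
        simp only [hf]
        ring
      · have := hk_meas
        fun_prop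
    rw [setLIntegral_congr_fun measurableSet_Ioi e2]
    rw [beta_lint (by linarith) (by linarith) (G := fun A => ENNReal.ofReal (hk A w))
      (by have := hk_meas; fun_prop)]
    simp only [hf]
    rw [show (s + t) / 2 = s / 2 + t / 2 by ring]
  have lhs : ∫⁻ x, (∫⁻ a in Set.Ioi (0:ℝ), f s a x) * (∫⁻ b in Set.Ioi (0:ℝ), f t b (w - x))
      = ENNReal.ofReal ((π ^ 2)⁻¹ * Real.Gamma (2 - s / 2) *
          ((π ^ 2)⁻¹ * Real.Gamma (2 - t / 2))) *
        ∫⁻ x, rk s x * rk t (w - x) := by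
    rw [← lintegral_const_mul _ (by have h1 := rk_meas s; have h2 := rk_meas t; fun_prop)]
    refine lintegral_congr_ae ?_
    filter_upwards [ae_ne_zero, ae_ne w] with x h0 h1
    rw [hrep s (by linarith) x h0, hrep t (by linarith) (w - x) (sub_ne_zero.mpr h1.symm),
      ENNReal.ofReal_mul (p := (π ^ 2)⁻¹ * Real.Gamma (2 - s / 2)) (by positivity)]
    ring
  rw [lhs] at main
  have hc : 0 < (π ^ 2)⁻¹ * Real.Gamma (2 - s / 2) * ((π ^ 2)⁻¹ * Real.Gamma (2 - t / 2)) := by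
    positivity
  rw [← ENNReal.mul_right_inj (a := ENNReal.ofReal ((π ^ 2)⁻¹ * Real.Gamma (2 - s / 2) *
          ((π ^ 2)⁻¹ * Real.Gamma (2 - t / 2)))) (by simpa using hc) ENNReal.ofReal_ne_top,
    main, ← mul_assoc, ← mul_assoc, ← ENNReal.ofReal_mul (by positivity),
    ← ENNReal.ofReal_mul hc.le]
  congr 2
  unfold C2
  generalize Real.Gamma (2 - s / 2) = x1 at *
  generalize Real.Gamma (2 - t / 2) = x2 at *
  generalize Real.Gamma (2 - (s + t) / 2) = x3 at *
  field_simp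

lemma riesz2 {s t : ℝ} (hs : 0 < s) (ht : 0 < t) (hst : s + t < 4) {g : E4 → ENNReal}
    (hg : Measurable g) :
    ∫⁻ y, ∫⁻ x, rk s x * rk t y * g (x + y)
      = ENNReal.ofReal (C2 s t) * ∫⁻ w, rk (s + t) w * g w := by
  have h1 := rk_meas s
  have h2 := rk_meas t
  have h3 := rk_meas (s + t)
  rw [lintegral_lintegral_swap (by
    apply Measurable.aemeasurable; unfold Function.uncurry; fun_prop)]
  have e : ∀ x, ∫⁻ y, rk s x * rk t y * g (x + y) = ∫⁻ w, rk s x * rk t (w - x) * g w := by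
    intro x
    rw [← lintegral_sub_right_eq_self (fun y => rk s x * rk t y * g (x + y)) x]
    simp
  simp_rw [e]
  rw [lintegral_lintegral_swap (by
    apply Measurable.aemeasurable; unfold Function.uncurry; fun_prop)]
  rw [← lintegral_const_mul _ (by fun_prop)]
  refine lintegral_congr_ae ?_
  filter_upwards [ae_ne_zero] with w hw
  rw [lintegral_mul_const _ (by fun_prop), riesz_pt hs ht hst hw, mul_assoc]

/-- Three-fold composition of Riesz kernels. -/
lemma riesz3 {s t u : ℝ} (hs : 0 < s) (ht : 0 < t) (hu : 0 < u) (hst : s + t + u < 4)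
    {g : E4 → ENNReal} (hg : Measurable g) :
    ∫⁻ q : E4 × E4 × E4, rk s q.1 * rk t q.2.1 * rk u q.2.2 * g (q.1 + q.2.1 + q.2.2)
      = ENNReal.ofReal (C2 s t * C2 (s + t) u) * ∫⁻ w, rk (s + t + u) w * g w := by
  have h1 := rk_meas s
  have h2 := rk_meas t
  have h3 := rk_meas u
  have h4 := rk_meas (s + t)
  rw [Measure.volume_eq_prod, lintegral_prod_symm _ (by fun_prop), Measure.volume_eq_prod,
    lintegral_prod_symm _ (by
      apply Measurable.aemeasurable
      apply Measurable.lintegral_prod_left'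
        (f := fun z : E4 × (E4 × E4) => rk s z.1 * rk t z.2.1 * rk u z.2.2
          * g (z.1 + z.2.1 + z.2.2))
      fun_prop)]
  have e : ∀ z, ∫⁻ y, ∫⁻ x, rk s x * rk t y * rk u z * g (x + y + z) =
      ENNReal.ofReal (C2 s t) * ∫⁻ w, rk (s + t) w * rk u z * g (w + z) := by
    intro z
    have := riesz2 hs ht (by linarith) (g := fun w => rk u z * g (w + z)) (by fun_prop)
    simp only [← mul_assoc] at this
    exact this
  simp only
  simp_rw [e]
  rw [lintegral_const_mul, riesz2 (add_pos hs ht) hu hst hg, ← mul_assoc,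
    ← ENNReal.ofReal_mul (C2_pos hs ht (by linarith)).le]
  apply Measurable.lintegral_prod_left'
        (f := fun z : E4 × E4 => rk (s + t) z.1 * rk u z.2
          * g (z.1 + z.2))
  fun_prop

/-- A decaying weight. -/
def dk (w : E4) : ℝ := ((1 + ‖w‖) ^ 8)⁻¹

lemma dk_pos (w : E4) : 0 < dk w := by unfold dk; positivity

lemma dk_meas : Measurable dk := by unfold dk; fun_prop

lemma dk_int {σ : ℝ} (h0 : 0 < σ) (h4 : σ < 4) :
    Integrable (fun w : E4 => ‖w‖ ^ (σ - 4) * dk w) := by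
  have := integrable_fun_norm_addHaar (volume : Measure E4)
    (f := fun r => r ^ (σ - 4) * ((1 + r) ^ 8)⁻¹)
  unfold dk
  rw [this]
  simp only [finrank_euclideanSpace, Fintype.card_fin, smul_eq_mul]
  have hmeas : Measurable (fun y : ℝ => y ^ (4 - 1) * (y ^ (σ - 4) * ((1 + y) ^ 8)⁻¹)) := by
    fun_prop
  rw [← Set.Ioc_union_Ioi_eq_Ioi (zero_le_one' ℝ)]
  refine IntegrableOn.union ?_ ?_
  · have hi : IntegrableOn (fun y : ℝ => y ^ (σ - 1)) (Set.Ioc 0 1) := by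
      have := intervalIntegral.intervalIntegrable_rpow' (a := 0) (b := 1)
        (show -1 < σ - 1 by linarith)
      rwa [intervalIntegrable_iff_integrableOn_Ioc_of_le zero_le_one] at this
    refine Integrable.mono' hi hmeas.aestronglyMeasurable ?_
    refine ae_restrict_of_forall_mem measurableSet_Ioc fun y hy => ?_
    have hy0 : 0 < y := hy.1
    rw [Real.norm_of_nonneg (by positivity), ← mul_assoc, ← Real.rpow_natCast,
      ← Real.rpow_add hy0]
    rw [show ((4 - 1 : ℕ) : ℝ) + (σ - 4) = σ - 1 by push_cast; ring]
    refine mul_le_of_le_one_right (by positivity) ?_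
    exact inv_le_one_of_one_le₀ (one_le_pow₀ (by linarith))
  · have hi : IntegrableOn (fun y : ℝ => y ^ (-2 : ℝ)) (Set.Ioi 1) :=
      integrableOn_Ioi_rpow_of_lt (by norm_num) one_pos
    refine Integrable.mono' hi hmeas.aestronglyMeasurable ?_
    refine ae_restrict_of_forall_mem measurableSet_Ioi fun y hy => ?_
    have hy1 : 1 < y := hy
    have hy0 : 0 < y := by linarith
    rw [Real.norm_of_nonneg (by positivity)]
    have a1 : y ^ (σ - 4) ≤ 1 := Real.rpow_le_one_of_one_le_of_nonpos hy1.le (by linarith)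
    have a2 : ((1 + y) ^ 8)⁻¹ ≤ (y ^ 8)⁻¹ := by
      gcongr; linarith
    have a3 : y ^ (-2 : ℝ) = (y ^ 2)⁻¹ := by
      rw [Real.rpow_neg hy0.le]; norm_num
    calc y ^ (4 - 1) * (y ^ (σ - 4) * ((1 + y) ^ 8)⁻¹) ≤ y ^ 3 * (1 * (y ^ 8)⁻¹) := by
          gcongr
      _ = (y ^ 5)⁻¹ := by field_simp
      _ ≤ (y ^ 2)⁻¹ := by
          gcongr
          · exact hy1.le
          · norm_num
      _ = _ := a3.symm

/-- The product of three real Riesz kernels. -/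
def K3 (s t u : ℝ) (q : E4 × E4 × E4) : ℝ :=
  ‖q.1‖ ^ (s - 4) * ‖q.2.1‖ ^ (t - 4) * ‖q.2.2‖ ^ (u - 4)

lemma K3_nonneg (s t u : ℝ) (q : E4 × E4 × E4) : 0 ≤ K3 s t u q := by unfold K3; positivity

lemma K3_meas (s t u : ℝ) : Measurable (K3 s t u) := by unfold K3; fun_prop

lemma K3_ofReal (s t u : ℝ) (q : E4 × E4 × E4) :
    ENNReal.ofReal (K3 s t u q) = rk s q.1 * rk t q.2.1 * rk u q.2.2 := by
  unfold K3 rk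
  rw [ENNReal.ofReal_mul (by positivity), ENNReal.ofReal_mul (by positivity)]

lemma tri_int {s t u : ℝ} (hs : 0 < s) (ht : 0 < t) (hu : 0 < u) (h4 : s + t + u < 4) :
    Integrable (fun q : E4 × E4 × E4 => K3 s t u q * dk (q.1 + q.2.1 + q.2.2)) := by
  refine ⟨?_, ?_⟩
  · have := K3_meas s t u
    have := dk_meas
    exact Measurable.aestronglyMeasurable (by fun_prop)
  · rw [hasFiniteIntegral_iff_ofReal (Filter.Eventually.of_forall fun q =>
      mul_nonneg (K3_nonneg _ _ _ _) (dk_pos _).le)]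
    simp_rw [ENNReal.ofReal_mul (K3_nonneg _ _ _ _), K3_ofReal]
    rw [riesz3 hs ht hu h4 (g := fun w => ENNReal.ofReal (dk w)) (by have := dk_meas; fun_prop)]
    have := (dk_int (show 0 < s + t + u by positivity) h4).2
    rw [hasFiniteIntegral_iff_ofReal (Filter.Eventually.of_forall fun q =>
      mul_nonneg (by positivity) (dk_pos _).le)] at this
    simp_rw [ENNReal.ofReal_mul (Real.rpow_nonneg (norm_nonneg _) _)] at this
    exact ENNReal.mul_lt_top ENNReal.ofReal_lt_top this

lemma tri_val {s t u : ℝ} (hs : 0 < s) (ht : 0 < t) (hu : 0 < u) (h4 : s + t + u < 4)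
    {ψ : E4 → ℝ} (hψ : Measurable ψ) :
    ∫ q : E4 × E4 × E4, K3 s t u q * ψ (q.1 + q.2.1 + q.2.2)
      = C2 s t * C2 (s + t) u * ∫ w, ‖w‖ ^ (s + t + u - 4) * ψ w := by
  have hK := K3_meas s t u
  have hC : 0 ≤ C2 s t * C2 (s + t) u :=
    mul_nonneg (C2_pos hs ht (by linarith)).le (C2_pos (by linarith) hu (by linarith)).le
  have hsum : Measurable (fun q : E4 × E4 × E4 => q.1 + q.2.1 + q.2.2) := by fun_prop
  have hμ : ((volume : Measure (E4 × E4 × E4)).withDensity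
      (fun q => ENNReal.ofReal (K3 s t u q))).map (fun q => q.1 + q.2.1 + q.2.2)
      = ENNReal.ofReal (C2 s t * C2 (s + t) u) • (volume : Measure E4).withDensity
        (rk (s + t + u)) := by
    refine Measure.ext_of_lintegral _ fun f hf => ?_
    rw [lintegral_map hf hsum, lintegral_withDensity_eq_lintegral_mul _ (by fun_prop)
      (by fun_prop), lintegral_smul_measure,
      lintegral_withDensity_eq_lintegral_mul _ (rk_meas _) hf]
    simp only [Pi.mul_apply, K3_ofReal, smul_eq_mul]
    exact riesz3 hs ht hu h4 hf
  have h1 : ∫ w, ψ w ∂(((volume : Measure (E4 × E4 × E4)).withDensity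
      (fun q => ENNReal.ofReal (K3 s t u q))).map (fun q => q.1 + q.2.1 + q.2.2)) =
      ∫ q : E4 × E4 × E4, K3 s t u q * ψ (q.1 + q.2.1 + q.2.2) := by
    rw [integral_map hsum.aemeasurable hψ.aestronglyMeasurable,
      integral_withDensity_eq_integral_toReal_smul (by fun_prop)
        (Filter.Eventually.of_forall fun _ => ENNReal.ofReal_lt_top)]
    simp [ENNReal.toReal_ofReal (K3_nonneg _ _ _ _)]
  rw [← h1, hμ, integral_smul_measure, ENNReal.toReal_ofReal hC,
    integral_withDensity_eq_integral_toReal_smul (rk_meas _)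
        (Filter.Eventually.of_forall fun _ => ENNReal.ofReal_lt_top)]
  simp [rk, ENNReal.toReal_ofReal (Real.rpow_nonneg (norm_nonneg _) _)]

lemma rpow_mul_norm_le (s : ℝ) (x : E4) : ‖x‖ ^ (s - 4) * ‖x‖ ≤ ‖x‖ ^ (s + 1 - 4) := by
  rcases eq_or_ne x 0 with rfl | hx
  · simp only [norm_zero, mul_zero]; positivity
  · have h : 0 < ‖x‖ := norm_pos_iff.mpr hx
    rw [show s + 1 - 4 = (s - 4) + 1 by ring, Real.rpow_add h, Real.rpow_one]

lemma dk_shift {c : ℝ} (hc : 1 / 2 ≤ c) (x p : E4) :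
    dk (c • x + p) ≤ (2 * (1 + ‖p‖)) ^ 8 * dk x := by
  unfold dk
  rw [← div_eq_mul_inv, inv_eq_one_div, div_le_div_iff₀ (by positivity) (by positivity), one_mul,
    ← mul_pow]
  gcongr
  have h1 : ‖c • x‖ ≤ ‖c • x + p‖ + ‖p‖ := by
    have := norm_sub_le (c • x + p) p
    simpa using this
  rw [norm_smul, Real.norm_of_nonneg (by linarith)] at h1
  have h2 : 1 / 2 * ‖x‖ ≤ c * ‖x‖ := by gcongr
  nlinarith [norm_nonneg p, norm_nonneg (c • x + p), mul_nonneg (norm_nonneg p) (norm_nonneg (c • x + p))]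

/-- Radial integration by parts, by differentiating in a scaling parameter. -/
lemma radial_ibp {s : ℝ} (hs : 0 < s) (hs3 : s < 3) {ψ : E4 → ℝ} {ψ' : E4 → E4 →L[ℝ] ℝ}
    (hd : ∀ x, HasFDerivAt ψ (ψ' x) x) (hc : Continuous ψ') {C : ℝ}
    (hb : ∀ x, ‖ψ x‖ ≤ C * dk x) (hb' : ∀ x, ‖ψ' x‖ ≤ C * dk x) (p : E4) :
    ∫ x, ‖x‖ ^ (s - 4) * ψ' (x + p) x = -s * ∫ x, ‖x‖ ^ (s - 4) * ψ (x + p) := by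
  have hC : 0 ≤ C := by
    have := (norm_nonneg _).trans (hb 0)
    exact nonneg_of_mul_nonneg_left this (dk_pos 0)
  have hψ : Continuous ψ := continuous_iff_continuousAt.mpr fun x => (hd x).continuousAt
  have hψm := hψ.measurable
  set F : ℝ → E4 → ℝ := fun c x => ‖x‖ ^ (s - 4) * ψ (c • x + p) with hF
  set F' : ℝ → E4 → ℝ := fun c x => ‖x‖ ^ (s - 4) * ψ' (c • x + p) x with hF'
  set bound : E4 → ℝ := fun x => C * (2 * (1 + ‖p‖)) ^ 8 * (‖x‖ ^ (s + 1 - 4) * dk x) with hbd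
  have hFm : ∀ c, Measurable (F c) := by intro c; simp only [hF]; fun_prop
  have hF'm : Measurable (F' 1) := by
    simp only [hF']
    have : Continuous (fun x => ψ' ((1:ℝ) • x + p) x) := by fun_prop
    have := this.measurable
    fun_prop
  have hint : Integrable (F 1) := by
    refine Integrable.mono' ((dk_int hs (by linarith)).const_mul (C * (2 * (1 + ‖p‖)) ^ 8))
      (hFm 1).aestronglyMeasurable (Filter.Eventually.of_forall fun x => ?_)
    simp only [hF, norm_mul]
    rw [Real.norm_of_nonneg (Real.rpow_nonneg (norm_nonneg x) _)]
    have h1 := hb ((1:ℝ) • x + p)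
    have h2 := dk_shift (c := 1) (by norm_num) x p
    calc _ ≤ ‖x‖ ^ (s - 4) * (C * ((2 * (1 + ‖p‖)) ^ 8 * dk x)) := by
          gcongr
          exact h1.trans (by gcongr)
      _ = _ := by ring
  have key := hasDerivAt_integral_of_dominated_loc_of_deriv_le (μ := volume) (F := F) (F' := F')
    (bound := bound) (x₀ := (1:ℝ)) (s := Set.Ioi (1/2)) (Ioi_mem_nhds (by norm_num))
    (Filter.Eventually.of_forall fun c => (hFm c).aestronglyMeasurable) hint
    hF'm.aestronglyMeasurable
    (Filter.Eventually.of_forall fun x c hc => by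
      have hc : 1 / 2 < c := hc
      have h1 := hb' (c • x + p)
      have h2 := dk_shift hc.le x p
      have h3 := rpow_mul_norm_le s x
      have h4 := (ψ' (c • x + p)).le_opNorm x
      simp only [hF', hbd, norm_mul]
      rw [Real.norm_of_nonneg (Real.rpow_nonneg (norm_nonneg x) _)]
      calc _ ≤ ‖x‖ ^ (s - 4) * (C * ((2 * (1 + ‖p‖)) ^ 8 * dk x) * ‖x‖) := by
            gcongr
            refine h4.trans ?_
            gcongr
            exact h1.trans (by gcongr)
        _ = C * (2 * (1 + ‖p‖)) ^ 8 * ((‖x‖ ^ (s - 4) * ‖x‖) * dk x) := by ring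
        _ ≤ _ := by
            have := dk_pos x
            gcongr)
    ((dk_int (by linarith) (by linarith)).const_mul _)
    (Filter.Eventually.of_forall fun x c _ => by
      have h1 : HasDerivAt (fun c : ℝ => c • x + p) x c := by
        simpa using ((hasDerivAt_id c).smul_const x).add_const p
      exact ((hd (c • x + p)).comp_hasDerivAt c h1).const_mul _)
  have hscale : ∀ c > 0, ∫ x, F c x = c ^ (-s) * ∫ x, F 1 x := by
    intro c hc
    have h1 := Measure.integral_comp_smul (volume : Measure E4)
      (fun x => ‖x‖ ^ (s - 4) * ψ (x + p)) c
    simp only [finrank_euclideanSpace, Fintype.card_fin, smul_eq_mul] at h1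
    have h2 : ∀ x : E4, ‖c • x‖ ^ (s - 4) * ψ (c • x + p) = c ^ (s - 4) * F c x := by
      intro x
      rw [norm_smul, Real.norm_of_nonneg hc.le, Real.mul_rpow hc.le (norm_nonneg x)]
      simp only [hF]; ring
    simp_rw [h2] at h1
    rw [integral_const_mul, abs_of_pos (by positivity)] at h1
    have h3 : c ^ (s - 4) = c ^ s * (c ^ 4)⁻¹ := by
      rw [Real.rpow_sub hc, div_eq_mul_inv]; norm_num
    have h4 : c ^ s ≠ 0 := (Real.rpow_pos_of_pos hc s).ne'
    simp only [hF, one_smul] at h1 ⊢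
    rw [Real.rpow_neg hc.le]
    rw [h3] at h1
    field_simp at h1 ⊢
    linarith
  have hder2 : HasDerivAt (fun c => ∫ x, F c x) (-s * ∫ x, F 1 x) 1 := by
    have h1 : HasDerivAt (fun c : ℝ => c ^ (-s)) (-s) 1 := by
      simpa using Real.hasDerivAt_rpow_const (x := 1) (p := -s) (Or.inl one_ne_zero)
    refine (h1.mul_const (∫ x, F 1 x)).congr_of_eventuallyEq ?_
    filter_upwards [Ioi_mem_nhds (show (0:ℝ) < 1 by norm_num)] with c hc
    exact hscale c hc
  have := key.2.unique hder2
  simpa [hF, hF'] using this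

lemma schwartz_dk {F : Type*} [NormedAddCommGroup F] [NormedSpace ℝ F] (f : SchwartzMap E4 F) :
    ∃ C, 0 ≤ C ∧ ∀ x, ‖f x‖ ≤ C * dk x := by
  refine ⟨2 ^ 8 * ((Finset.Iic (8, 0)).sup fun m => SchwartzMap.seminorm ℝ m.1 m.2) f,
    by positivity, fun x => ?_⟩
  have := SchwartzMap.one_add_le_sup_seminorm_apply (𝕜 := ℝ) (m := (8, 0)) (k := 8) (n := 0)
    le_rfl le_rfl f x
  simp only at this
  rw [norm_iteratedFDeriv_zero] at this
  unfold dk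
  rw [← div_eq_mul_inv, le_div_iff₀ (by positivity)]
  linarith

section derivs

set_option maxSynthPendingDepth 3

/-- First derivative as a Schwartz function. -/
def D1 (φ : SchwartzMap E4 ℝ) : SchwartzMap E4 (E4 →L[ℝ] ℝ) := fderivCLM ℝ E4 ℝ φ
/-- Second derivative. -/
def D2 (φ : SchwartzMap E4 ℝ) : SchwartzMap E4 (E4 →L[ℝ] E4 →L[ℝ] ℝ) :=
  fderivCLM ℝ E4 _ (D1 φ)
/-- Third derivative. -/
def D3 (φ : SchwartzMap E4 ℝ) : SchwartzMap E4 (E4 →L[ℝ] E4 →L[ℝ] E4 →L[ℝ] ℝ) :=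
  fderivCLM ℝ E4 _ (D2 φ)

lemma hasD1 (φ : SchwartzMap E4 ℝ) (p : E4) : HasFDerivAt φ (D1 φ p) p := φ.hasFDerivAt p
lemma hasD2 (φ : SchwartzMap E4 ℝ) (p z : E4) :
    HasFDerivAt (fun p => D1 φ p z) ((D2 φ p).flip z) p := by
  have := ((D1 φ).hasFDerivAt p).clm_apply (hasFDerivAt_const z p)
  refine this.congr_fderiv ?_
  ext; simp [D2]
lemma hasD3 (φ : SchwartzMap E4 ℝ) (p y z : E4) :
    HasFDerivAt (fun p => D2 φ p y z) (((D3 φ p).flip y).flip z) p := by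
  have := (((D2 φ).hasFDerivAt p).clm_apply (hasFDerivAt_const y p)).clm_apply
    (hasFDerivAt_const z p)
  refine this.congr_fderiv ?_
  ext; simp [D3]

lemma thirdDeriv_eq (φ : SchwartzMap E4 ℝ) (p x y z : E4) :
    thirdDeriv φ p x y z = D3 φ p x y z := by
  unfold thirdDeriv
  have h1 : ∀ q, fderiv ℝ (fun y => fderiv ℝ φ y z) q y = D2 φ q y z := by
    intro q
    have := (hasD2 φ q z).fderiv
    rw [show (fun y => fderiv ℝ φ y z) = (fun p => D1 φ p z) from rfl, this]; rfl
  simp_rw [h1]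
  rw [(hasD3 φ p y z).fderiv]; rfl

lemma basis_sum (x : E4) : x = ∑ i : Fin 4, x i • EuclideanSpace.single i (1 : ℝ) := by
  ext j
  simp [Finset.sum_apply, Pi.single_apply]

lemma sum_eq (φ : SchwartzMap E4 ℝ) (p x y z : E4) :
    ∑ i : Fin 4, ∑ j : Fin 4, ∑ k : Fin 4, x i * y j * z k *
            thirdDeriv (⇑φ) p (EuclideanSpace.single i 1)
              (EuclideanSpace.single j 1) (EuclideanSpace.single k 1) = D3 φ p x y z := by
  have h1 : D3 φ p x = ∑ i : Fin 4, x i • D3 φ p (EuclideanSpace.single i 1) := by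
    conv_lhs => rw [basis_sum x]
    simp only [map_sum, map_smul]
  have h2 : ∀ i, D3 φ p (EuclideanSpace.single i 1) y =
      ∑ j : Fin 4, y j • D3 φ p (EuclideanSpace.single i 1) (EuclideanSpace.single j 1) := by
    intro i
    conv_lhs => rw [basis_sum y]
    simp only [map_sum, map_smul]
  have h3 : ∀ i j, D3 φ p (EuclideanSpace.single i 1) (EuclideanSpace.single j 1) z =
      ∑ k : Fin 4, z k • D3 φ p (EuclideanSpace.single i 1) (EuclideanSpace.single j 1)
        (EuclideanSpace.single k 1) := by
    intro i j
    conv_lhs => rw [basis_sum z]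
    simp only [map_sum, map_smul]
  simp only [h1, ContinuousLinearMap.sum_apply, ContinuousLinearMap.smul_apply, h2, h3,
    thirdDeriv_eq, smul_eq_mul, Finset.mul_sum]
  refine Finset.sum_congr rfl fun i _ => Finset.sum_congr rfl fun j _ =>
    Finset.sum_congr rfl fun k _ => by ring

lemma D3_bound (φ : SchwartzMap E4 ℝ) : ∃ C, 0 ≤ C ∧ ∀ p x y z,
    ‖D3 φ p x y z‖ ≤ C * dk p * ‖x‖ * ‖y‖ * ‖z‖ := by
  obtain ⟨C, h0, hC⟩ := schwartz_dk (D3 φ)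
  refine ⟨C, h0, fun p x y z => ?_⟩
  refine ((D3 φ p x y).le_opNorm z).trans ?_
  gcongr
  refine ((D3 φ p x).le_opNorm y).trans ?_
  gcongr
  refine ((D3 φ p).le_opNorm x).trans ?_
  gcongr
  exact hC p

lemma D2_bound (φ : SchwartzMap E4 ℝ) : ∃ C, 0 ≤ C ∧ ∀ p y z,
    ‖D2 φ p y z‖ ≤ C * dk p * ‖y‖ * ‖z‖ := by
  obtain ⟨C, h0, hC⟩ := schwartz_dk (D2 φ)
  refine ⟨C, h0, fun p y z => ?_⟩
  refine ((D2 φ p y).le_opNorm z).trans ?_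
  gcongr
  refine ((D2 φ p).le_opNorm y).trans ?_
  gcongr
  exact hC p

lemma D1_bound (φ : SchwartzMap E4 ℝ) : ∃ C, 0 ≤ C ∧ ∀ p z,
    ‖D1 φ p z‖ ≤ C * dk p * ‖z‖ := by
  obtain ⟨C, h0, hC⟩ := schwartz_dk (D1 φ)
  refine ⟨C, h0, fun p z => ?_⟩
  refine ((D1 φ p).le_opNorm z).trans ?_
  gcongr
  exact hC p

/-- Integration by parts in the first variable. -/
lemma ibp_x {s : ℝ} (hs : 0 < s) (hs3 : s < 3) (φ : SchwartzMap E4 ℝ) (p y z : E4) :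
    ∫ x, ‖x‖ ^ (s - 4) * D3 φ (x + p) x y z = -s * ∫ x, ‖x‖ ^ (s - 4) * D2 φ (x + p) y z := by
  obtain ⟨C3, h3, hC3⟩ := D3_bound φ
  obtain ⟨C2, h2, hC2⟩ := D2_bound φ
  refine radial_ibp (C := (C3 + C2) * ‖y‖ * ‖z‖) hs hs3 (ψ := fun p => D2 φ p y z)
    (ψ' := fun p => ((D3 φ p).flip y).flip z)
    (fun x => hasD3 φ x y z) ?_ ?_ ?_ p
  · have : Continuous (D3 φ) := (D3 φ).continuous
    have h1 : Continuous fun p => (D3 φ p).flip y :=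
      ((ContinuousLinearMap.flipₗᵢ ℝ E4 E4 (E4 →L[ℝ] ℝ)).continuous.comp this).clm_apply
        continuous_const
    exact ((ContinuousLinearMap.flipₗᵢ ℝ E4 E4 ℝ).continuous.comp h1).clm_apply
        continuous_const
  · intro x
    refine (hC2 x y z).trans ?_
    have := dk_pos x
    have : 0 ≤ C3 * dk x * ‖y‖ * ‖z‖ := by positivity
    linarith
  · intro x
    have := dk_pos x
    refine ContinuousLinearMap.opNorm_le_bound _ (by positivity) fun w => ?_
    refine (hC3 x w y z).trans ?_
    have : 0 ≤ C2 * dk x * ‖y‖ * ‖z‖ * ‖w‖ := by positivity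
    linarith

lemma ibp_y {s : ℝ} (hs : 0 < s) (hs3 : s < 3) (φ : SchwartzMap E4 ℝ) (p z : E4) :
    ∫ y, ‖y‖ ^ (s - 4) * D2 φ (y + p) y z = -s * ∫ y, ‖y‖ ^ (s - 4) * D1 φ (y + p) z := by
  obtain ⟨C3, h3, hC3⟩ := D2_bound φ
  obtain ⟨C2, h2, hC2⟩ := D1_bound φ
  refine radial_ibp (C := (C3 + C2) * ‖z‖) hs hs3 (ψ := fun p => D1 φ p z)
    (ψ' := fun p => (D2 φ p).flip z)
    (fun x => hasD2 φ x z) ?_ ?_ ?_ p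
  · have : Continuous (D2 φ) := (D2 φ).continuous
    exact ((ContinuousLinearMap.flipₗᵢ ℝ E4 E4 ℝ).continuous.comp this).clm_apply
        continuous_const
  · intro x
    refine (hC2 x z).trans ?_
    have := dk_pos x
    have : 0 ≤ C3 * dk x * ‖z‖ := by positivity
    linarith
  · intro x
    have := dk_pos x
    refine ContinuousLinearMap.opNorm_le_bound _ (by positivity) fun w => ?_
    refine (hC3 x w z).trans ?_
    have : 0 ≤ C2 * dk x * ‖z‖ * ‖w‖ := by positivity
    linarith

lemma ibp_z {s : ℝ} (hs : 0 < s) (hs3 : s < 3) (φ : SchwartzMap E4 ℝ) (p : E4) :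
    ∫ z, ‖z‖ ^ (s - 4) * D1 φ (z + p) z = -s * ∫ z, ‖z‖ ^ (s - 4) * φ (z + p) := by
  obtain ⟨C3, h3, hC3⟩ := schwartz_dk (D1 φ)
  obtain ⟨C2, h2, hC2⟩ := schwartz_dk φ
  refine radial_ibp (C := C3 + C2) hs hs3 (ψ := φ) (ψ' := D1 φ)
    (fun x => hasD1 φ x) (D1 φ).continuous ?_ ?_ p
  · intro x
    refine (hC2 x).trans ?_
    have := dk_pos x
    gcongr; linarith
  · intro x
    refine (hC3 x).trans ?_
    have := dk_pos x
    gcongr; linarith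

/-- Fubini for an identity in the first variable. -/
lemma step_lemma {G1 G2 : E4 × E4 × E4 → ℝ} (h1 : Integrable G1) (h2 : Integrable G2) {c : ℝ}
    (h : ∀ b, ∫ a, G1 (a, b) = c * ∫ a, G2 (a, b)) : ∫ q, G1 q = c * ∫ q, G2 q := by
  rw [Measure.volume_eq_prod] at *
  rw [integral_prod_symm _ h1, integral_prod_symm _ h2, ← integral_const_mul]
  exact integral_congr_ae (Filter.Eventually.of_forall h)

/-- Cyclic permutation of the variables. -/
def cyc : E4 × E4 × E4 ≃ᵐ E4 × E4 × E4 := MeasurableEquiv.prodComm.trans MeasurableEquiv.prodAssoc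

lemma cyc_apply (x y z : E4) : cyc (x, y, z) = (y, z, x) := rfl

lemma cyc_mp : MeasurePreserving cyc := by
  refine MeasurePreserving.trans (μb := (volume : Measure ((E4 × E4) × E4))) ?_ ?_
  · exact Measure.measurePreserving_swap
  · exact volume_preserving_prodAssoc

lemma K3_cyc (s t u : ℝ) (q : E4 × E4 × E4) : K3 s t u q = K3 t u s (cyc q) := by
  rcases q with ⟨x, y, z⟩
  simp only [cyc_apply, K3]; ring

lemma step_y {G1 G2 : E4 × E4 × E4 → ℝ} (h1 : Integrable G1) (h2 : Integrable G2) {c : ℝ}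
    (h : ∀ x z, ∫ y, G1 (x, y, z) = c * ∫ y, G2 (x, y, z)) : ∫ q, G1 q = c * ∫ q, G2 q := by
  have e1 : MeasurePreserving cyc.symm := cyc_mp.symm cyc
  rw [← e1.integral_comp' G1, ← e1.integral_comp' G2]
  refine step_lemma ((e1.integrable_comp_emb cyc.symm.measurableEmbedding).mpr h1)
    ((e1.integrable_comp_emb cyc.symm.measurableEmbedding).mpr h2) fun b => ?_
  exact h b.2 b.1

lemma step_z {G1 G2 : E4 × E4 × E4 → ℝ} (h1 : Integrable G1) (h2 : Integrable G2) {c : ℝ}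
    (h : ∀ x y, ∫ z, G1 (x, y, z) = c * ∫ z, G2 (x, y, z)) : ∫ q, G1 q = c * ∫ q, G2 q := by
  have e1 : MeasurePreserving cyc := cyc_mp
  rw [← e1.integral_comp' G1, ← e1.integral_comp' G2]
  refine step_lemma ((e1.integrable_comp_emb cyc.measurableEmbedding).mpr h1)
    ((e1.integrable_comp_emb cyc.measurableEmbedding).mpr h2) fun b => ?_
  exact h b.1 b.2

end derivs

section values

set_option maxSynthPendingDepth 3

lemma K3_mono1 (s t u : ℝ) (q : E4 × E4 × E4) :
    K3 s t u q * ‖q.1‖ * ‖q.2.1‖ * ‖q.2.2‖ ≤ K3 (s + 1) (t + 1) (u + 1) q := by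
  have h1 := rpow_mul_norm_le s q.1
  have h2 := rpow_mul_norm_le t q.2.1
  have h3 := rpow_mul_norm_le u q.2.2
  unfold K3
  calc _ = (‖q.1‖ ^ (s - 4) * ‖q.1‖) * (‖q.2.1‖ ^ (t - 4) * ‖q.2.1‖) *
        (‖q.2.2‖ ^ (u - 4) * ‖q.2.2‖) := by ring
    _ ≤ _ := by gcongr

lemma K3_mono2 (s t u : ℝ) (q : E4 × E4 × E4) :
    K3 s t u q * ‖q.2.1‖ * ‖q.2.2‖ ≤ K3 s (t + 1) (u + 1) q := by
  have h2 := rpow_mul_norm_le t q.2.1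
  have h3 := rpow_mul_norm_le u q.2.2
  unfold K3
  calc _ = (‖q.1‖ ^ (s - 4)) * (‖q.2.1‖ ^ (t - 4) * ‖q.2.1‖) *
        (‖q.2.2‖ ^ (u - 4) * ‖q.2.2‖) := by ring
    _ ≤ _ := by gcongr

lemma K3_mono3 (s t u : ℝ) (q : E4 × E4 × E4) :
    K3 s t u q * ‖q.2.2‖ ≤ K3 s t (u + 1) q := by
  have h3 := rpow_mul_norm_le u q.2.2
  unfold K3
  calc _ = (‖q.1‖ ^ (s - 4)) * (‖q.2.1‖ ^ (t - 4)) *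
        (‖q.2.2‖ ^ (u - 4) * ‖q.2.2‖) := by ring
    _ ≤ _ := by gcongr

lemma D3_meas (φ : SchwartzMap E4 ℝ) : Measurable (fun q : E4 × E4 × E4 =>
    D3 φ (q.1 + q.2.1 + q.2.2) q.1 q.2.1 q.2.2) := by
  have : Continuous (D3 φ) := (D3 φ).continuous
  have h : Continuous (fun q : E4 × E4 × E4 =>
    D3 φ (q.1 + q.2.1 + q.2.2) q.1 q.2.1 q.2.2) := by fun_prop
  exact h.measurable

lemma int3 {s t u : ℝ} (hs : 0 < s + 1) (ht : 0 < t + 1) (hu : 0 < u + 1) (h : s + t + u < 1)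
    (φ : SchwartzMap E4 ℝ) : Integrable (fun q : E4 × E4 × E4 =>
      K3 s t u q * D3 φ (q.1 + q.2.1 + q.2.2) q.1 q.2.1 q.2.2) := by
  obtain ⟨C, h0, hC⟩ := D3_bound φ
  have hK := K3_meas s t u
  refine Integrable.mono' ((tri_int hs ht hu (by linarith)).const_mul C)
    (hK.mul (D3_meas φ)).aestronglyMeasurable (Filter.Eventually.of_forall fun q => ?_)
  rw [norm_mul, Real.norm_of_nonneg (K3_nonneg _ _ _ _)]
  have hd := dk_pos (q.1 + q.2.1 + q.2.2)
  calc _ ≤ K3 s t u q * (C * dk (q.1 + q.2.1 + q.2.2) * ‖q.1‖ * ‖q.2.1‖ * ‖q.2.2‖) := by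
        gcongr
        · exact K3_nonneg _ _ _ _
        · exact hC _ _ _ _
    _ = C * ((K3 s t u q * ‖q.1‖ * ‖q.2.1‖ * ‖q.2.2‖) * dk (q.1 + q.2.1 + q.2.2)) := by ring
    _ ≤ _ := by
        gcongr
        exact K3_mono1 s t u q

lemma int2 {s t u : ℝ} (hs : 0 < s) (ht : 0 < t) (hu : 0 < u) (h : s + t + u < 1)
    (φ : SchwartzMap E4 ℝ) : Integrable (fun q : E4 × E4 × E4 =>
      K3 s t u q * D2 φ (q.1 + q.2.1 + q.2.2) q.2.1 q.2.2) := by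
  obtain ⟨C, h0, hC⟩ := D2_bound φ
  have hK := K3_meas s t u
  have hm : Measurable (fun q : E4 × E4 × E4 => D2 φ (q.1 + q.2.1 + q.2.2) q.2.1 q.2.2) := by
    have : Continuous (D2 φ) := (D2 φ).continuous
    have h : Continuous (fun q : E4 × E4 × E4 =>
      D2 φ (q.1 + q.2.1 + q.2.2) q.2.1 q.2.2) := by fun_prop
    exact h.measurable
  refine Integrable.mono' ((tri_int (s := s) (t := t + 1) (u := u + 1) hs (by linarith)
    (by linarith) (by linarith)).const_mul C)
    (hK.mul hm).aestronglyMeasurable (Filter.Eventually.of_forall fun q => ?_)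
  rw [norm_mul, Real.norm_of_nonneg (K3_nonneg _ _ _ _)]
  have hd := dk_pos (q.1 + q.2.1 + q.2.2)
  calc _ ≤ K3 s t u q * (C * dk (q.1 + q.2.1 + q.2.2) * ‖q.2.1‖ * ‖q.2.2‖) := by
        gcongr
        · exact K3_nonneg _ _ _ _
        · exact hC _ _ _
    _ = C * ((K3 s t u q * ‖q.2.1‖ * ‖q.2.2‖) * dk (q.1 + q.2.1 + q.2.2)) := by ring
    _ ≤ _ := by
        gcongr
        exact K3_mono2 s t u q

lemma int1 {s t u : ℝ} (hs : 0 < s) (ht : 0 < t) (hu : 0 < u) (h : s + t + u < 1)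
    (φ : SchwartzMap E4 ℝ) : Integrable (fun q : E4 × E4 × E4 =>
      K3 s t u q * D1 φ (q.1 + q.2.1 + q.2.2) q.2.2) := by
  obtain ⟨C, h0, hC⟩ := D1_bound φ
  have hK := K3_meas s t u
  have hm : Measurable (fun q : E4 × E4 × E4 => D1 φ (q.1 + q.2.1 + q.2.2) q.2.2) := by
    have : Continuous (D1 φ) := (D1 φ).continuous
    have h : Continuous (fun q : E4 × E4 × E4 =>
      D1 φ (q.1 + q.2.1 + q.2.2) q.2.2) := by fun_prop
    exact h.measurable
  refine Integrable.mono' ((tri_int (s := s) (t := t) (u := u + 1) hs (by linarith)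
    (by linarith) (by linarith)).const_mul C)
    (hK.mul hm).aestronglyMeasurable (Filter.Eventually.of_forall fun q => ?_)
  rw [norm_mul, Real.norm_of_nonneg (K3_nonneg _ _ _ _)]
  have hd := dk_pos (q.1 + q.2.1 + q.2.2)
  calc _ ≤ K3 s t u q * (C * dk (q.1 + q.2.1 + q.2.2) * ‖q.2.2‖) := by
        gcongr
        · exact K3_nonneg _ _ _ _
        · exact hC _ _
    _ = C * ((K3 s t u q * ‖q.2.2‖) * dk (q.1 + q.2.1 + q.2.2)) := by ring
    _ ≤ _ := by
        gcongr
        exact K3_mono3 s t u q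

lemma int0 {s t u : ℝ} (hs : 0 < s) (ht : 0 < t) (hu : 0 < u) (h : s + t + u < 1)
    (φ : SchwartzMap E4 ℝ) : Integrable (fun q : E4 × E4 × E4 =>
      K3 s t u q * φ (q.1 + q.2.1 + q.2.2)) := by
  obtain ⟨C, h0, hC⟩ := schwartz_dk φ
  have hK := K3_meas s t u
  have hm : Measurable (fun q : E4 × E4 × E4 => φ (q.1 + q.2.1 + q.2.2)) := by
    have := φ.continuous.measurable
    fun_prop
  refine Integrable.mono' ((tri_int (s := s) (t := t) (u := u) hs (by linarith)
    (by linarith) (by linarith)).const_mul C)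
    (hK.mul hm).aestronglyMeasurable (Filter.Eventually.of_forall fun q => ?_)
  rw [norm_mul, Real.norm_of_nonneg (K3_nonneg _ _ _ _)]
  calc _ ≤ K3 s t u q * (C * dk (q.1 + q.2.1 + q.2.2)) := by
        gcongr
        · exact K3_nonneg _ _ _ _
        · exact hC _
    _ = _ := by ring

/-- The one-point functional `∫ |w|^{σ-4} w·∇φ(w) dw`. -/
def Jf (φ : SchwartzMap E4 ℝ) (σ : ℝ) : ℝ := ∫ w : E4, ‖w‖ ^ (σ - 4) * D1 φ w w

/-- `Γ(1+s/2)/Γ(2-s/2)`. -/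
def Af (s : ℝ) : ℝ := Real.Gamma (1 + s / 2) / Real.Gamma (2 - s / 2)

/-- The normalised composition constant. -/
def bb (s t u : ℝ) : ℝ := Af s * Af t * Af u / Af (s + t + u)

end values

section values2

set_option maxSynthPendingDepth 3

lemma tri_ibp {s t u : ℝ} (hs : 0 < s) (ht : 0 < t) (hu : 0 < u) (h : s + t + u < 1)
    (φ : SchwartzMap E4 ℝ) :
    ∫ q : E4 × E4 × E4, K3 s t u q * D3 φ (q.1 + q.2.1 + q.2.2) q.1 q.2.1 q.2.2
      = -s * (-t * (-u * ∫ q : E4 × E4 × E4, K3 s t u q * φ (q.1 + q.2.1 + q.2.2))) := by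
  rw [step_lemma (int3 (by linarith) (by linarith) (by linarith) h φ) (int2 hs ht hu h φ) (c := -s),
    step_y (int2 hs ht hu h φ) (int1 hs ht hu h φ) (c := -t),
    step_z (int1 hs ht hu h φ) (int0 hs ht hu h φ) (c := -u)]
  · intro x y
    have e1 : ∀ z, K3 s t u (x, y, z) * D1 φ (x + y + z) z =
        (‖x‖ ^ (s - 4) * ‖y‖ ^ (t - 4)) * (‖z‖ ^ (u - 4) * D1 φ (z + (x + y)) z) := by
      intro z
      rw [show x + y + z = z + (x + y) by abel]; simp only [K3]; ring
    have e2 : ∀ z, K3 s t u (x, y, z) * φ (x + y + z) =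
        (‖x‖ ^ (s - 4) * ‖y‖ ^ (t - 4)) * (‖z‖ ^ (u - 4) * φ (z + (x + y))) := by
      intro z
      rw [show x + y + z = z + (x + y) by abel]; simp only [K3]; ring
    simp only [e1, e2]
    rw [integral_const_mul, integral_const_mul, ibp_z hu (by linarith)]
    ring
  · intro x z
    have e1 : ∀ y, K3 s t u (x, y, z) * D2 φ (x + y + z) y z =
        (‖x‖ ^ (s - 4) * ‖z‖ ^ (u - 4)) * (‖y‖ ^ (t - 4) * D2 φ (y + (x + z)) y z) := by
      intro y
      rw [show x + y + z = y + (x + z) by abel]; simp only [K3]; ring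
    have e2 : ∀ y, K3 s t u (x, y, z) * D1 φ (x + y + z) z =
        (‖x‖ ^ (s - 4) * ‖z‖ ^ (u - 4)) * (‖y‖ ^ (t - 4) * D1 φ (y + (x + z)) z) := by
      intro y
      rw [show x + y + z = y + (x + z) by abel]; simp only [K3]; ring
    simp only [e1, e2]
    rw [integral_const_mul, integral_const_mul, ibp_y ht (by linarith)]
    ring
  · intro b
    have e1 : ∀ x, K3 s t u (x, b) * D3 φ (x + b.1 + b.2) x b.1 b.2 =
        (‖b.1‖ ^ (t - 4) * ‖b.2‖ ^ (u - 4)) *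
          (‖x‖ ^ (s - 4) * D3 φ (x + (b.1 + b.2)) x b.1 b.2) := by
      intro x
      rw [show x + b.1 + b.2 = x + (b.1 + b.2) by abel]; simp only [K3]; ring
    have e2 : ∀ x, K3 s t u (x, b) * D2 φ (x + b.1 + b.2) b.1 b.2 =
        (‖b.1‖ ^ (t - 4) * ‖b.2‖ ^ (u - 4)) *
          (‖x‖ ^ (s - 4) * D2 φ (x + (b.1 + b.2)) b.1 b.2) := by
      intro x
      rw [show x + b.1 + b.2 = x + (b.1 + b.2) by abel]; simp only [K3]; ring
    simp only [e1, e2]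
    rw [integral_const_mul, integral_const_mul, ibp_x hs (by linarith)]
    ring

lemma C2_bb {s t u : ℝ} (hs : 0 < s) (ht : 0 < t) (hu : 0 < u) (h : s + t + u < 1) :
    s * t * u * (C2 s t * C2 (s + t) u) = 4 * π ^ 4 * bb s t u * (s + t + u) := by
  unfold C2 bb Af
  have g : ∀ x : ℝ, 0 < x → Real.Gamma (1 + x / 2) = x / 2 * Real.Gamma (x / 2) := by
    intro x hx
    rw [add_comm, Real.Gamma_add_one (by positivity)]
  rw [g s hs, g t ht, g u hu, g (s + t + u) (by positivity)]
  rw [show (s + t) / 2 + u / 2 = (s + t + u) / 2 by ring, show s / 2 + t / 2 = (s + t) / 2 by ring]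
  have p1 : 0 < Real.Gamma (s / 2) := Real.Gamma_pos_of_pos (by linarith)
  have p2 : 0 < Real.Gamma (t / 2) := Real.Gamma_pos_of_pos (by linarith)
  have p3 : 0 < Real.Gamma (u / 2) := Real.Gamma_pos_of_pos (by linarith)
  have p4 : 0 < Real.Gamma ((s + t) / 2) := Real.Gamma_pos_of_pos (by linarith)
  have p5 : 0 < Real.Gamma ((s + t + u) / 2) := Real.Gamma_pos_of_pos (by linarith)
  have p6 : 0 < Real.Gamma (2 - s / 2) := Real.Gamma_pos_of_pos (by linarith)
  have p7 : 0 < Real.Gamma (2 - t / 2) := Real.Gamma_pos_of_pos (by linarith)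
  have p8 : 0 < Real.Gamma (2 - u / 2) := Real.Gamma_pos_of_pos (by linarith)
  have p9 : 0 < Real.Gamma (2 - (s + t) / 2) := Real.Gamma_pos_of_pos (by linarith)
  have p10 : 0 < Real.Gamma (2 - (s + t + u) / 2) := Real.Gamma_pos_of_pos (by linarith)
  have : 0 < s + t + u := by positivity
  generalize Real.Gamma (s / 2) = a1 at *
  generalize Real.Gamma (t / 2) = a2 at *
  generalize Real.Gamma (u / 2) = a3 at *
  generalize Real.Gamma ((s + t) / 2) = a4 at *
  generalize Real.Gamma ((s + t + u) / 2) = a5 at *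
  generalize Real.Gamma (2 - s / 2) = a6 at *
  generalize Real.Gamma (2 - t / 2) = a7 at *
  generalize Real.Gamma (2 - u / 2) = a8 at *
  generalize Real.Gamma (2 - (s + t) / 2) = a9 at *
  generalize Real.Gamma (2 - (s + t + u) / 2) = a10 at *
  field_simp
  ring

lemma M_val {s t u : ℝ} (hs : 0 < s) (ht : 0 < t) (hu : 0 < u) (h : s + t + u < 1)
    (φ : SchwartzMap E4 ℝ) :
    ∫ q : E4 × E4 × E4, K3 s t u q * D3 φ (q.1 + q.2.1 + q.2.2) q.1 q.2.1 q.2.2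
      = 4 * π ^ 4 * bb s t u * Jf φ (s + t + u) := by
  rw [tri_ibp hs ht hu h, tri_val hs ht hu (by linarith) φ.continuous.measurable]
  have := ibp_z (s := s + t + u) (by positivity) (by linarith) φ 0
  simp only [add_zero] at this
  rw [Jf, this]
  linear_combination (-∫ w, ‖w‖ ^ (s + t + u - 4) * φ w) * C2_bb hs ht hu h

end values2

section expansions
open Asymptotics Filter Topology

/-- `f` has a third order Taylor expansion at `0+`. -/
def Ex3 (f : ℝ → ℝ) (a b c d : ℝ) : Prop :=
  (fun s => f s - (a + b * s + c * s ^ 2 + d * s ^ 3)) =o[𝓝[>] (0 : ℝ)] (fun s => s ^ 3)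

lemma tend0 : Tendsto (fun s : ℝ => s) (𝓝[>] (0 : ℝ)) (𝓝 0) :=
  tendsto_nhdsWithin_of_tendsto_nhds tendsto_id

lemma pow_lo {m : ℕ} (hm : 4 ≤ m) : (fun s : ℝ => s ^ m) =o[𝓝[>] (0 : ℝ)] (fun s => s ^ 3) :=
  (isLittleO_pow_pow (by omega : 3 < m)).mono nhdsWithin_le_nhds

lemma Ex3.congr {f g : ℝ → ℝ} {a b c d : ℝ} (hf : Ex3 f a b c d)
    (h : f =ᶠ[𝓝[>] (0 : ℝ)] g) : Ex3 g a b c d := by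
  refine IsLittleO.congr' hf ?_ EventuallyEq.rfl
  filter_upwards [h] with s hs
  rw [hs]

lemma Ex3.ofBigO {f : ℝ → ℝ} {a b c d : ℝ} (C : ℝ)
    (h : ∀ᶠ s in 𝓝[>] (0 : ℝ), |f s - (a + b * s + c * s ^ 2 + d * s ^ 3)| ≤ C * s ^ 4) :
    Ex3 f a b c d := by
  refine IsBigO.trans_isLittleO (g := fun s : ℝ => s ^ 4) ?_ (pow_lo le_rfl)
  refine IsBigO.of_bound C ?_
  filter_upwards [h] with s hs
  rwa [Real.norm_eq_abs, Real.norm_of_nonneg (by positivity)]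

lemma Ex3.add {f g : ℝ → ℝ} {a b c d a' b' c' d' : ℝ} (hf : Ex3 f a b c d)
    (hg : Ex3 g a' b' c' d') :
    Ex3 (fun s => f s + g s) (a + a') (b + b') (c + c') (d + d') := by
  refine (IsLittleO.add hf hg).congr_left fun s => ?_
  ring

lemma Ex3.const_mul {f : ℝ → ℝ} {a b c d : ℝ} (hf : Ex3 f a b c d) (k : ℝ) :
    Ex3 (fun s => k * f s) (k * a) (k * b) (k * c) (k * d) := by
  refine (IsLittleO.const_mul_left hf k).congr_left fun s => ?_
  ring

lemma Ex3.scale {f : ℝ → ℝ} {a b c d : ℝ} (hf : Ex3 f a b c d) {k : ℝ} (hk : 0 < k) :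
    Ex3 (fun s => f (k * s)) a (k * b) (k ^ 2 * c) (k ^ 3 * d) := by
  have ht : Tendsto (fun s : ℝ => k * s) (𝓝[>] (0 : ℝ)) (𝓝[>] (0 : ℝ)) := by
    refine tendsto_nhdsWithin_iff.2 ⟨?_, ?_⟩
    · simpa using tend0.const_mul k
    · filter_upwards [self_mem_nhdsWithin] with s hs
      exact mul_pos hk hs
  have := (IsLittleO.comp_tendsto hf ht)
  refine (this.congr_left (f₂ := fun s => f (k * s) -
    (a + (k * b) * s + (k ^ 2 * c) * s ^ 2 + (k ^ 3 * d) * s ^ 3)) fun s => ?_).trans_isBigO ?_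
  · simp only [Function.comp]; ring
  · refine IsBigO.of_bound (k ^ 3) (Eventually.of_forall fun s => ?_)
    simp only [Function.comp, mul_pow, norm_mul, norm_pow, Real.norm_of_nonneg hk.le]
    exact le_rfl

lemma Ex3.mul {f g : ℝ → ℝ} {a b c d a' b' c' d' : ℝ} (hf : Ex3 f a b c d)
    (hg : Ex3 g a' b' c' d') :
    Ex3 (fun s => f s * g s) (a * a') (a * b' + b * a') (a * c' + b * b' + c * a')
      (a * d' + b * c' + c * b' + d * a') := by
  have hP : (fun s : ℝ => a + b * s + c * s ^ 2 + d * s ^ 3) =O[𝓝[>] (0 : ℝ)]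
      (fun _ => (1 : ℝ)) := by
    have : Tendsto (fun s : ℝ => a + b * s + c * s ^ 2 + d * s ^ 3) (𝓝[>] (0 : ℝ))
        (𝓝 (a + b * 0 + c * 0 ^ 2 + d * 0 ^ 3)) := by
      refine tendsto_nhdsWithin_of_tendsto_nhds (Continuous.tendsto ?_ 0)
      fun_prop
    exact this.isBigO_one ℝ
  have hQ : (fun s : ℝ => a' + b' * s + c' * s ^ 2 + d' * s ^ 3) =O[𝓝[>] (0 : ℝ)]
      (fun _ => (1 : ℝ)) := by
    have : Tendsto (fun s : ℝ => a' + b' * s + c' * s ^ 2 + d' * s ^ 3) (𝓝[>] (0 : ℝ))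
        (𝓝 (a' + b' * 0 + c' * 0 ^ 2 + d' * 0 ^ 3)) := by
      refine tendsto_nhdsWithin_of_tendsto_nhds (Continuous.tendsto ?_ 0)
      fun_prop
    exact this.isBigO_one ℝ
  have h3 : (fun s : ℝ => s ^ 3) =O[𝓝[>] (0 : ℝ)] (fun _ => (1 : ℝ)) :=
    (tendsto_nhdsWithin_of_tendsto_nhds
      ((continuous_pow 3).tendsto (0 : ℝ))).isBigO_one ℝ
  have t1 := (IsLittleO.mul_isBigO hf hQ)
  have t2 := (IsBigO.mul_isLittleO hP hg)
  have t3 := IsLittleO.mul_isBigO hf (hg.isBigO.trans h3)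
  have p4 := (pow_lo (m := 4) le_rfl).const_mul_left (b * d' + c * c' + d * b')
  have p5 := (pow_lo (m := 5) (by norm_num)).const_mul_left (c * d' + d * c')
  have p6 := (pow_lo (m := 6) (by norm_num)).const_mul_left (d * d')
  simp only [mul_one, one_mul] at t1 t2 t3
  refine (((((t1.add t2).add t3).add p4).add p5).add p6).congr_left fun s => ?_
  ring

lemma Ex3.exp {f : ℝ → ℝ} {d : ℝ} (hf : Ex3 f 0 0 0 d) :
    Ex3 (fun s => Real.exp (f s)) 1 0 0 d := by
  have hO : f =O[𝓝[>] (0 : ℝ)] (fun s => s ^ 3) := by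
    have h1 := hf.isBigO.add ((isBigO_refl (fun s : ℝ => s ^ 3) (𝓝[>] (0 : ℝ))).const_mul_left d)
    refine h1.congr_left fun s => by ring
  have h3 : Tendsto (fun s : ℝ => s ^ 3) (𝓝[>] (0 : ℝ)) (𝓝 0) := by
    simpa using tend0.pow 3
  have ht : Tendsto f (𝓝[>] (0 : ℝ)) (𝓝 0) := hO.trans_tendsto h3
  have hE : (fun s => Real.exp (f s) - 1 - f s) =O[𝓝[>] (0 : ℝ)] (fun s => f s * f s) := by
    refine IsBigO.of_bound 1 ?_
    have : ∀ᶠ s in 𝓝[>] (0 : ℝ), |f s| ≤ 1 := by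
      have := ht.abs
      simp only [abs_zero] at this
      exact this.eventually_le_const one_pos
    filter_upwards [this] with s hs
    have := Real.abs_exp_sub_one_sub_id_le hs
    rw [Real.norm_eq_abs, one_mul, norm_mul, Real.norm_eq_abs, abs_mul_abs_self]
    nlinarith
  have h6 : (fun s => Real.exp (f s) - 1 - f s) =o[𝓝[>] (0 : ℝ)] (fun s => s ^ 3) := by
    refine (hE.trans (hO.mul hO)).trans_isLittleO ?_
    refine (pow_lo (m := 6) (by norm_num)).congr_left fun s => by ring
  refine (h6.add hf).congr_left fun s => by ring

lemma Ex3.inv_one_sub (k : ℝ) (_hk : 0 ≤ k) :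
    Ex3 (fun s => (1 - k * s)⁻¹) 1 k (k ^ 2) (k ^ 3) := by
  refine Ex3.ofBigO (2 * k ^ 4) ?_
  have : ∀ᶠ s in 𝓝[>] (0 : ℝ), k * s ≤ 1 / 2 := by
    have := tend0.const_mul k
    rw [mul_zero] at this
    exact this.eventually_le_const (by norm_num)
  filter_upwards [this, self_mem_nhdsWithin] with s hs hs0
  have hs0 : 0 < s := hs0
  have hp : 0 < 1 - k * s := by linarith
  have : (1 - k * s)⁻¹ - (1 + k * s + k ^ 2 * s ^ 2 + k ^ 3 * s ^ 3) =
      k ^ 4 * s ^ 4 * (1 - k * s)⁻¹ := by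
    field_simp
    ring
  rw [this, abs_of_nonneg (by positivity)]
  have h2 : (1 - k * s)⁻¹ ≤ 2 := by
    rw [inv_le_comm₀ hp (by norm_num)]; linarith
  calc _ ≤ k ^ 4 * s ^ 4 * 2 := by gcongr
    _ = _ := by ring

lemma Ex3.one_sub (k : ℝ) : Ex3 (fun s => 1 - k * s) 1 (-k) 0 0 := by
  refine Ex3.ofBigO 0 (Eventually.of_forall fun s => ?_)
  ring_nf
  simp

lemma Ex3.tendsto_div {f : ℝ → ℝ} {d : ℝ} (hf : Ex3 f 0 0 0 d) :
    Tendsto (fun s => f s / s ^ 3) (𝓝[>] (0 : ℝ)) (𝓝 d) := by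
  have h := (IsLittleO.tendsto_div_nhds_zero hf).add_const d
  rw [zero_add] at h
  refine h.congr' ?_
  filter_upwards [self_mem_nhdsWithin] with s hs
  have hs0 : (s : ℝ) ≠ 0 := (ne_of_gt hs)
  field_simp
  ring

end expansions

section gammaexp
open Filter Topology

lemma log_ratio_bound {x : ℝ} (hx : |x| ≤ 1 / 2) :
    |Real.log (1 + x) - Real.log (1 - x) - 2 * x - 2 / 3 * x ^ 3| ≤ 4 * |x| ^ 5 := by
  have h1 := Real.abs_log_sub_add_sum_range_le (x := x) (by linarith) 4
  have h2 := Real.abs_log_sub_add_sum_range_le (x := -x) (by rw [abs_neg]; linarith) 4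
  simp only [Finset.sum_range_succ, Finset.sum_range_zero, abs_neg, sub_neg_eq_add] at h1 h2
  norm_num at h1 h2
  have h3 : |x| ^ 5 / (1 - |x|) ≤ 2 * |x| ^ 5 := by
    rw [div_le_iff₀ (by linarith)]
    have : 0 ≤ |x| ^ 5 := by positivity
    nlinarith
  have h1' := abs_le.1 (h1.trans h3)
  have h2' := abs_le.1 (h2.trans h3)
  rw [abs_le]
  constructor <;> nlinarith [h1'.1, h1'.2, h2'.1, h2'.2]

/-- `log Γ(1+u) - log Γ(1-u)`. -/
def gg (u : ℝ) : ℝ := Real.log (Real.Gamma (1 + u)) - Real.log (Real.Gamma (1 - u))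

lemma summ3 : Summable (fun n : ℕ => 1 / ((n : ℝ) + 1) ^ 3) := by
  have := (summable_nat_add_iff (f := fun n : ℕ => 1 / (n : ℝ) ^ 3) 1).2
    (Real.summable_one_div_nat_pow.2 (by norm_num))
  simpa using this

lemma gg_bound {u : ℝ} (hu : |u| ≤ 1 / 2) :
    |gg u + 2 * Real.eulerMascheroniConstant * u + 2 / 3 * zeta3 * u ^ 3|
      ≤ 4 * zeta3 * |u| ^ 5 := by
  have hu' := abs_le.1 hu
  have t1 := Real.BohrMollerup.tendsto_log_gamma (x := 1 + u) (by linarith)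
  have t2 := Real.BohrMollerup.tendsto_log_gamma (x := 1 - u) (by linarith)
  have hz : Tendsto (fun n : ℕ => ∑ i ∈ Finset.range (n + 1), 1 / ((i : ℝ) + 1) ^ 3) atTop
      (𝓝 zeta3) := (tendsto_add_atTop_iff_nat 1).2 summ3.hasSum.tendsto_sum_nat
  have hH : Tendsto (fun n : ℕ => (∑ i ∈ Finset.range (n + 1), 1 / ((i : ℝ) + 1)) - Real.log n)
      atTop (𝓝 Real.eulerMascheroniConstant) := by
    have h1 := Real.tendsto_harmonic_sub_log.add
      (tendsto_one_div_add_atTop_nhds_zero_nat (𝕜 := ℝ))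
    rw [add_zero] at h1
    refine h1.congr fun n => ?_
    rw [Finset.sum_range_succ, harmonic]
    push_cast
    simp only [one_div]
    ring
  have key := ((t1.sub t2).add (hH.const_mul (2 * u))).add (hz.const_mul (2 / 3 * u ^ 3))
  have key2 : Tendsto (fun n : ℕ => |Real.BohrMollerup.logGammaSeq (1 + u) n
      - Real.BohrMollerup.logGammaSeq (1 - u) n
      + 2 * u * ((∑ i ∈ Finset.range (n + 1), 1 / ((i : ℝ) + 1)) - Real.log n)
      + 2 / 3 * u ^ 3 * ∑ i ∈ Finset.range (n + 1), 1 / ((i : ℝ) + 1) ^ 3|) atTop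
      (𝓝 |gg u + 2 * Real.eulerMascheroniConstant * u + 2 / 3 * zeta3 * u ^ 3|) := by
    have := key.abs
    rw [show gg u + 2 * Real.eulerMascheroniConstant * u + 2 / 3 * zeta3 * u ^ 3 =
      Real.log (Real.Gamma (1 + u)) - Real.log (Real.Gamma (1 - u)) +
        2 * u * Real.eulerMascheroniConstant + 2 / 3 * u ^ 3 * zeta3 by unfold gg; ring]
    exact this
  refine le_of_tendsto key2 (Eventually.of_forall fun n => ?_)
  have e : Real.BohrMollerup.logGammaSeq (1 + u) n
      - Real.BohrMollerup.logGammaSeq (1 - u) n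
      + 2 * u * ((∑ i ∈ Finset.range (n + 1), 1 / ((i : ℝ) + 1)) - Real.log n)
      + 2 / 3 * u ^ 3 * ∑ i ∈ Finset.range (n + 1), 1 / ((i : ℝ) + 1) ^ 3 =
      ∑ i ∈ Finset.range (n + 1), -(Real.log (1 + u / (i + 1)) - Real.log (1 - u / (i + 1))
        - 2 * (u / (i + 1)) - 2 / 3 * (u / (i + 1)) ^ 3) := by
    have e1 : ∀ i : ℕ, -(Real.log (1 + u / (i + 1)) - Real.log (1 - u / (i + 1))
        - 2 * (u / (i + 1)) - 2 / 3 * (u / (i + 1)) ^ 3) =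
        Real.log (1 - u + i) - Real.log (1 + u + i) + 2 * u * (1 / ((i : ℝ) + 1)) +
          2 / 3 * u ^ 3 * (1 / ((i : ℝ) + 1) ^ 3) := by
      intro i
      have hi : (0 : ℝ) < i + 1 := by positivity
      have hi0 : (0 : ℝ) ≤ i := by positivity
      rw [show 1 + u / ((i : ℝ) + 1) = (1 + u + i) / (i + 1) by field_simp; ring,
        show 1 - u / ((i : ℝ) + 1) = (1 - u + i) / (i + 1) by field_simp; ring,
        Real.log_div (by linarith) hi.ne', Real.log_div (by linarith) hi.ne', div_pow]
      ring
    simp only [e1, Finset.sum_add_distrib, Finset.sum_sub_distrib, ← Finset.mul_sum]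
    unfold Real.BohrMollerup.logGammaSeq
    ring
  rw [e]
  calc _ ≤ ∑ i ∈ Finset.range (n + 1), |-(Real.log (1 + u / (i + 1)) - Real.log (1 - u / (i + 1))
        - 2 * (u / (i + 1)) - 2 / 3 * (u / (i + 1)) ^ 3)| := Finset.abs_sum_le_sum_abs _ _
    _ ≤ ∑ i ∈ Finset.range (n + 1), 4 * |u| ^ 5 * (1 / ((i : ℝ) + 1) ^ 3) := by
        refine Finset.sum_le_sum fun i _ => ?_
        rw [abs_neg]
        have hi : (1 : ℝ) ≤ i + 1 := by
          have : (0 : ℝ) ≤ i := by positivity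
          linarith
        have ha : |u / ((i : ℝ) + 1)| = |u| / (i + 1) := by
          rw [abs_div, abs_of_pos (by linarith : (0 : ℝ) < i + 1)]
        refine (log_ratio_bound ?_).trans ?_
        · rw [ha]
          exact (div_le_self (abs_nonneg u) hi).trans hu
        · rw [ha, div_pow, div_eq_mul_one_div, mul_assoc]
          gcongr
          norm_num
    _ = 4 * |u| ^ 5 * ∑ i ∈ Finset.range (n + 1), (1 / ((i : ℝ) + 1) ^ 3) := by
        rw [Finset.mul_sum]
    _ ≤ 4 * |u| ^ 5 * zeta3 := by
        gcongr
        exact summ3.sum_le_tsum _ (fun i _ => by positivity)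
    _ = _ := by ring

lemma gg_ex : Ex3 gg 0 (-2 * Real.eulerMascheroniConstant) 0 (-(2 / 3) * zeta3) := by
  refine Ex3.ofBigO (4 * zeta3) ?_
  have h : ∀ᶠ s in 𝓝[>] (0 : ℝ), s ≤ 1 / 2 := tend0.eventually_le_const (by norm_num)
  have hz : 0 ≤ zeta3 := tsum_nonneg fun i => by positivity
  filter_upwards [h, self_mem_nhdsWithin] with s hs hs0
  have hs0 : 0 < s := hs0
  have := gg_bound (u := s) (by rw [abs_of_pos hs0]; exact hs)
  rw [abs_of_pos hs0] at this
  calc _ = |gg s + 2 * Real.eulerMascheroniConstant * s + 2 / 3 * zeta3 * s ^ 3| := by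
        congr 1; ring
    _ ≤ _ := this
    _ ≤ 4 * zeta3 * s ^ 4 := by
        gcongr 4 * zeta3 * ?_
        exact pow_le_pow_of_le_one hs0.le (by linarith) (by norm_num)

lemma Af_eq {s : ℝ} (h0 : 0 < s) (h1 : s < 1) :
    Af s = Real.exp (gg (s / 2)) * (1 - s / 2)⁻¹ := by
  have p1 : 0 < Real.Gamma (1 + s / 2) := Real.Gamma_pos_of_pos (by linarith)
  have p2 : 0 < Real.Gamma (1 - s / 2) := Real.Gamma_pos_of_pos (by linarith)
  unfold Af gg
  rw [Real.exp_sub, Real.exp_log p1, Real.exp_log p2,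
    show 2 - s / 2 = (1 - s / 2) + 1 by ring, Real.Gamma_add_one (by linarith)]
  have : 0 < 1 - s / 2 := by linarith
  field_simp

lemma bb_ex {a b c : ℝ} (ha : 0 < a) (hb : 0 < b) (hc : 0 < c) :
    Ex3 (fun s => bb (a * s) (b * s) (c * s)) 1 0 (-(a * b + b * c + a * c) / 4)
      (((a + b + c) * (a * b + b * c + a * c) - a * b * c) * (2 * zeta3 - 1) / 8) := by
  have ga := gg_ex.scale (k := a / 2) (by positivity)
  have gb := gg_ex.scale (k := b / 2) (by positivity)
  have gc := gg_ex.scale (k := c / 2) (by positivity)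
  have gs := (gg_ex.scale (k := (a + b + c) / 2) (by positivity)).const_mul (-1)
  have g := ((ga.add gb).add gc).add gs
  have he : Ex3 (fun s => Real.exp (gg (a / 2 * s) + gg (b / 2 * s) + gg (c / 2 * s) +
      -1 * gg ((a + b + c) / 2 * s))) 1 0 0
      (zeta3 / 4 * ((a + b + c) * (a * b + b * c + a * c) - a * b * c)) := by
    refine Ex3.exp ?_
    convert g using 1 <;> ring
  have h := (((he.mul (Ex3.one_sub ((a + b + c) / 2))).mul
    (Ex3.inv_one_sub (a / 2) (by positivity))).mul
    (Ex3.inv_one_sub (b / 2) (by positivity))).mul (Ex3.inv_one_sub (c / 2) (by positivity))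
  have h' : Ex3 (fun s => Real.exp (gg (a / 2 * s) + gg (b / 2 * s) + gg (c / 2 * s) +
      -1 * gg ((a + b + c) / 2 * s)) * (1 - (a + b + c) / 2 * s) * (1 - a / 2 * s)⁻¹ *
      (1 - b / 2 * s)⁻¹ * (1 - c / 2 * s)⁻¹) 1 0 (-(a * b + b * c + a * c) / 4)
      (((a + b + c) * (a * b + b * c + a * c) - a * b * c) * (2 * zeta3 - 1) / 8) := by
    convert h using 1 <;> ring
  refine h'.congr ?_
  have hev : ∀ᶠ s in 𝓝[>] (0 : ℝ), (a + b + c) * s < 1 := by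
    have := tend0.const_mul (a + b + c)
    rw [mul_zero] at this
    exact this.eventually_lt_const (by norm_num)
  filter_upwards [hev, self_mem_nhdsWithin] with s hs hs0
  have hs0 : 0 < s := hs0
  have qa : 0 < a * s := by positivity
  have qb : 0 < b * s := by positivity
  have qc : 0 < c * s := by positivity
  have hs' : a * s + b * s + c * s < 1 := by linarith
  unfold bb
  rw [Af_eq qa (by linarith), Af_eq qb (by linarith), Af_eq qc (by linarith),
    Af_eq (by positivity) hs',
    show a / 2 * s = a * s / 2 by ring, show b / 2 * s = b * s / 2 by ring,
    show c / 2 * s = c * s / 2 by ring,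
    show (a + b + c) / 2 * s = (a * s + b * s + c * s) / 2 by ring,
    show ∀ x : ℝ, -1 * x = -x from fun x => by ring, Real.exp_add, Real.exp_add, Real.exp_add,
    Real.exp_neg]
  have : 0 < 1 - (a * s + b * s + c * s) / 2 := by linarith
  field_simp

end gammaexp

section jtaylor
open Filter Topology

set_option maxSynthPendingDepth 3

/-- log-moment functionals. -/
def Jk (φ : SchwartzMap E4 ℝ) (l : ℝ) (k : ℕ) : ℝ :=
  ∫ w : E4, ‖w‖ ^ (-(4 : ℝ)) * Real.log (‖w‖ / l) ^ k * D1 φ w w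

lemma exp_abs_half {r l : ℝ} (hr : 0 < r) (hl : 0 < l) :
    Real.exp (|Real.log (r / l)| / 2) ≤
      l ^ (-(1 / 2 : ℝ)) * r ^ (1 / 2 : ℝ) + l ^ (1 / 2 : ℝ) * r ^ (-(1 / 2 : ℝ)) := by
  have e1 : l ^ (-(1 / 2 : ℝ)) * r ^ (1 / 2 : ℝ) = Real.exp (Real.log (r / l) / 2) := by
    rw [Real.log_div hr.ne' hl.ne', Real.rpow_def_of_pos hl, Real.rpow_def_of_pos hr,
      ← Real.exp_add]
    congr 1; ring
  have e2 : l ^ (1 / 2 : ℝ) * r ^ (-(1 / 2 : ℝ)) = Real.exp (-Real.log (r / l) / 2) := by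
    rw [Real.log_div hr.ne' hl.ne', Real.rpow_def_of_pos hl, Real.rpow_def_of_pos hr,
      ← Real.exp_add]
    congr 1; ring
  rw [e1, e2]
  rcases abs_cases (Real.log (r / l)) with ⟨h, _⟩ | ⟨h, _⟩ <;> rw [h]
  · have := Real.exp_pos (-Real.log (r / l) / 2); linarith
  · have := Real.exp_pos (Real.log (r / l) / 2); linarith

lemma J_int (φ : SchwartzMap E4 ℝ) {l : ℝ} (hl : 0 < l) {f : ℝ → ℝ} (hf : Measurable f) {B : ℝ}
    (hB : ∀ L, |f L| ≤ B * Real.exp (|L| / 2)) :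
    Integrable (fun w : E4 => ‖w‖ ^ (-(4 : ℝ)) * f (Real.log (‖w‖ / l)) * D1 φ w w) := by
  obtain ⟨C, hC0, hC⟩ := D1_bound φ
  have hB0 : 0 ≤ B := by
    have := (abs_nonneg _).trans (hB 0)
    simpa using this
  have i1 := (dk_int (σ := 3 / 2) (by norm_num) (by norm_num)).const_mul
    (B * C * l ^ (-(1 / 2 : ℝ)))
  have i2 := (dk_int (σ := 1 / 2) (by norm_num) (by norm_num)).const_mul
    (B * C * l ^ (1 / 2 : ℝ))
  refine Integrable.mono' (i1.add i2) ?_ ?_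
  · have h1 : Measurable (fun w : E4 => D1 φ w w) := by
      have : Continuous (D1 φ) := (D1 φ).continuous
      have h : Continuous (fun w : E4 => D1 φ w w) := by fun_prop
      exact h.measurable
    have h2 : Measurable (fun w : E4 => f (Real.log (‖w‖ / l))) := by fun_prop
    have h3 : Measurable (fun w : E4 => ‖w‖ ^ (-(4 : ℝ))) := by fun_prop
    exact ((h3.mul h2).mul h1).aestronglyMeasurable
  · filter_upwards [ae_ne_zero] with w hw
    have hr : 0 < ‖w‖ := norm_pos_iff.mpr hw
    have hd := dk_pos w
    rw [norm_mul, norm_mul, Real.norm_of_nonneg (by positivity : 0 ≤ ‖w‖ ^ (-(4 : ℝ))),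
      Real.norm_eq_abs (f _)]
    have hb := (hB (Real.log (‖w‖ / l))).trans
      (mul_le_mul_of_nonneg_left (exp_abs_half hr hl) hB0)
    calc _ ≤ ‖w‖ ^ (-(4 : ℝ)) * (B * (l ^ (-(1 / 2 : ℝ)) * ‖w‖ ^ (1 / 2 : ℝ) +
          l ^ (1 / 2 : ℝ) * ‖w‖ ^ (-(1 / 2 : ℝ)))) * (C * dk w * ‖w‖) := by
          gcongr
          exact hC w w
      _ = B * C * l ^ (-(1 / 2 : ℝ)) * (‖w‖ ^ (3 / 2 - 4 : ℝ) * dk w) +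
          B * C * l ^ (1 / 2 : ℝ) * (‖w‖ ^ (1 / 2 - 4 : ℝ) * dk w) := by
          rw [show (3 / 2 - 4 : ℝ) = -4 + (1 / 2) + 1 by norm_num,
            show (1 / 2 - 4 : ℝ) = -4 + (-(1 / 2)) + 1 by norm_num,
            Real.rpow_add hr, Real.rpow_add hr, Real.rpow_add hr, Real.rpow_add hr,
            Real.rpow_one]
          ring

lemma pow_le_exp (k : ℕ) (L : ℝ) : |L ^ k| ≤ (4 ^ k * k.factorial) * Real.exp (|L| / 4) := by
  have := Real.pow_div_factorial_le_exp (|L| / 4) (by positivity) k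
  rw [div_le_iff₀ (by positivity), div_pow, div_le_iff₀ (by positivity)] at this
  rw [abs_pow]
  linarith

lemma exp_quarter (L : ℝ) : Real.exp (|L| / 4) ≤ Real.exp (|L| / 2) := by
  apply Real.exp_le_exp.2
  have := abs_nonneg L
  linarith

lemma Jk_int (φ : SchwartzMap E4 ℝ) {l : ℝ} (hl : 0 < l) (k : ℕ) :
    Integrable (fun w : E4 => ‖w‖ ^ (-(4 : ℝ)) * Real.log (‖w‖ / l) ^ k * D1 φ w w) :=
  J_int φ hl (f := fun L => L ^ k) (by fun_prop) (B := 4 ^ k * k.factorial)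
    fun L => (pow_le_exp k L).trans (mul_le_mul_of_nonneg_left (exp_quarter L) (by positivity))

lemma exp_taylor (x : ℝ) :
    |Real.exp x - (1 + x + x ^ 2 / 2 + x ^ 3 / 6)| ≤ |x| ^ 4 * Real.exp |x| := by
  have h := Complex.norm_exp_sub_sum_le_norm_mul_exp (x : ℂ) 4
  rw [Complex.norm_real, Real.norm_eq_abs] at h
  rw [← Real.norm_eq_abs, ← Complex.norm_real]
  convert h using 3
  simp [Finset.sum_range_succ, Nat.factorial]

lemma JL_ex (φ : SchwartzMap E4 ℝ) {l : ℝ} (hl : 0 < l) :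
    Ex3 (fun σ => l ^ (-σ) * Jf φ σ) (Jk φ l 0) (Jk φ l 1) (Jk φ l 2 / 2) (Jk φ l 3 / 6) := by
  have hI := J_int φ hl (f := fun L => L ^ 4 * Real.exp (|L| / 4)) (by fun_prop)
    (B := 4 ^ 4 * (4 : ℕ).factorial) (fun L => by
      rw [abs_mul, Real.abs_exp]
      calc _ ≤ (4 ^ 4 * (4 : ℕ).factorial) * Real.exp (|L| / 4) * Real.exp (|L| / 4) := by
            gcongr
            exact pow_le_exp 4 L
        _ = _ := by rw [mul_assoc, ← Real.exp_add]; congr 2; ring)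
  refine Ex3.ofBigO (∫ w : E4, ‖‖w‖ ^ (-(4 : ℝ)) * (Real.log (‖w‖ / l) ^ 4 *
    Real.exp (|Real.log (‖w‖ / l)| / 4)) * D1 φ w w‖) ?_
  have h : ∀ᶠ s in 𝓝[>] (0 : ℝ), s ≤ 1 / 4 := tend0.eventually_le_const (by norm_num)
  filter_upwards [h, self_mem_nhdsWithin] with s hs hs0
  have hs0 : 0 < s := hs0
  have hE := J_int φ hl (f := fun L => Real.exp (s * L)) (by fun_prop) (B := 1) (fun L => by
    rw [Real.abs_exp, one_mul]
    apply Real.exp_le_exp.2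
    have := abs_nonneg L
    have := le_abs_self L
    nlinarith)
  have e1 : l ^ (-s) * Jf φ s =
      ∫ w : E4, ‖w‖ ^ (-(4 : ℝ)) * Real.exp (s * Real.log (‖w‖ / l)) * D1 φ w w := by
    unfold Jf
    rw [← integral_const_mul]
    refine integral_congr_ae ?_
    filter_upwards [ae_ne_zero] with w hw
    have hr : 0 < ‖w‖ := norm_pos_iff.mpr hw
    rw [Real.log_div hr.ne' hl.ne', mul_sub, Real.exp_sub, mul_comm s, mul_comm s,
      ← Real.rpow_def_of_pos hr, ← Real.rpow_def_of_pos hl, sub_eq_add_neg s 4,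
      Real.rpow_add hr, Real.rpow_neg hl.le]
    field_simp
  have i0 := Jk_int φ hl 0
  have i1 := Jk_int φ hl 1
  have i2 := Jk_int φ hl 2
  have i3 := Jk_int φ hl 3
  have e2 : l ^ (-s) * Jf φ s - (Jk φ l 0 + Jk φ l 1 * s + Jk φ l 2 / 2 * s ^ 2 +
      Jk φ l 3 / 6 * s ^ 3) = ∫ w : E4, ((‖w‖ ^ (-(4 : ℝ)) * Real.exp (s * Real.log (‖w‖ / l)) *
        D1 φ w w) - ((‖w‖ ^ (-(4 : ℝ)) * Real.log (‖w‖ / l) ^ 0 * D1 φ w w +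
          (‖w‖ ^ (-(4 : ℝ)) * Real.log (‖w‖ / l) ^ 1 * D1 φ w w) * s +
          (‖w‖ ^ (-(4 : ℝ)) * Real.log (‖w‖ / l) ^ 2 * D1 φ w w) * (s ^ 2 / 2)) +
          (‖w‖ ^ (-(4 : ℝ)) * Real.log (‖w‖ / l) ^ 3 * D1 φ w w) * (s ^ 3 / 6))) := by
    have j1 := i1.mul_const s
    have j2 := i2.mul_const (s ^ 2 / 2)
    have j3 := i3.mul_const (s ^ 3 / 6)
    rw [integral_sub hE (((i0.fun_add j1).fun_add j2).fun_add j3),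
      integral_add ((i0.fun_add j1).fun_add j2) j3,
      integral_add (i0.fun_add j1) j2, integral_add i0 j1, integral_mul_const, integral_mul_const,
      integral_mul_const, e1]
    unfold Jk
    ring
  rw [e2, ← Real.norm_eq_abs, mul_comm, ← integral_const_mul]
  refine norm_integral_le_of_norm_le (hI.norm.const_mul _) (Eventually.of_forall fun w => ?_)
  set L := Real.log (‖w‖ / l)
  have e3 : (‖w‖ ^ (-(4 : ℝ)) * Real.exp (s * L) *
        D1 φ w w) - ((‖w‖ ^ (-(4 : ℝ)) * L ^ 0 * D1 φ w w +
          (‖w‖ ^ (-(4 : ℝ)) * L ^ 1 * D1 φ w w) * s +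
          (‖w‖ ^ (-(4 : ℝ)) * L ^ 2 * D1 φ w w) * (s ^ 2 / 2)) +
          (‖w‖ ^ (-(4 : ℝ)) * L ^ 3 * D1 φ w w) * (s ^ 3 / 6)) =
      ‖w‖ ^ (-(4 : ℝ)) * (Real.exp (s * L) - (1 + s * L + (s * L) ^ 2 / 2 + (s * L) ^ 3 / 6)) *
        D1 φ w w := by ring
  rw [e3, norm_mul, norm_mul, norm_mul, norm_mul, Real.norm_eq_abs (Real.exp _ - _),
    norm_mul, Real.norm_of_nonneg (Real.exp_pos _).le]
  have h4 : |Real.exp (s * L) - (1 + s * L + (s * L) ^ 2 / 2 + (s * L) ^ 3 / 6)| ≤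
      s ^ 4 * (‖L ^ 4‖ * Real.exp (|L| / 4)) := by
    refine (exp_taylor _).trans ?_
    rw [abs_mul, abs_of_pos hs0, mul_pow, norm_pow, Real.norm_eq_abs, mul_assoc]
    gcongr
    have := abs_nonneg L
    nlinarith
  calc _ ≤ ‖‖w‖ ^ (-(4 : ℝ))‖ * (s ^ 4 * (‖L ^ 4‖ * Real.exp (|L| / 4))) * ‖D1 φ w w‖ := by
        gcongr
    _ = _ := by ring

end jtaylor

section jzero
open Filter Topology Set

set_option maxSynthPendingDepth 3

lemma radial_one (φ : SchwartzMap E4 ℝ) (ω : E4) (hω : ‖ω‖ = 1) :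
    ∫ r in Ioi (0 : ℝ), D1 φ (r • ω) ω = - φ 0 := by
  obtain ⟨C, h0, hC⟩ := schwartz_dk φ
  obtain ⟨C', h0', hC'⟩ := D1_bound φ
  have hd : ∀ r ∈ Ici (0 : ℝ), HasDerivAt (fun r : ℝ => φ (r • ω)) (D1 φ (r • ω) ω) r := by
    intro r _
    have h1 : HasDerivAt (fun r : ℝ => r • ω) ω r := by
      simpa using (hasDerivAt_id r).smul_const ω
    exact (hasD1 φ (r • ω)).comp_hasDerivAt r h1
  have hdk : ∀ r : ℝ, dk (r • ω) ≤ (1 + r ^ 2)⁻¹ := by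
    intro r
    unfold dk
    rw [norm_smul, hω, mul_one, Real.norm_eq_abs]
    refine inv_anti₀ (by positivity) ?_
    have h1 : (1 : ℝ) ≤ 1 + |r| := by have := abs_nonneg r; linarith
    calc 1 + r ^ 2 ≤ (1 + |r|) ^ 2 := by
          rw [← sq_abs r]; have := abs_nonneg r; nlinarith
      _ ≤ _ := pow_le_pow_right₀ h1 (by norm_num)
  have hi : IntegrableOn (fun r : ℝ => D1 φ (r • ω) ω) (Ioi 0) := by
    refine Integrable.integrableOn ?_
    refine Integrable.mono' (integrable_inv_one_add_sq.const_mul C') ?_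
      (Eventually.of_forall fun r => ?_)
    · have : Continuous (D1 φ) := (D1 φ).continuous
      have h : Continuous (fun r : ℝ => D1 φ (r • ω) ω) := by fun_prop
      exact h.aestronglyMeasurable
    · refine (hC' _ _).trans ?_
      rw [hω, mul_one]
      exact mul_le_mul_of_nonneg_left (hdk r) h0'
  have ht : Tendsto (fun r : ℝ => φ (r • ω)) atTop (𝓝 0) := by
    have hz : Tendsto (fun r : ℝ => C * (1 + r ^ 2)⁻¹) atTop (𝓝 0) := by
      have : Tendsto (fun r : ℝ => 1 + r ^ 2) atTop atTop :=
        tendsto_atTop_add_const_left _ _ (tendsto_pow_atTop (by norm_num))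
      simpa using (tendsto_inv_atTop_zero.comp this).const_mul C
    exact squeeze_zero_norm (fun r => (hC _).trans (mul_le_mul_of_nonneg_left (hdk r) h0)) hz
  have := integral_Ioi_of_hasDerivAt_of_tendsto' hd hi ht
  rw [this]
  simp

lemma J0_val (φ : SchwartzMap E4 ℝ) {l : ℝ} (hl : 0 < l) : Jk φ l 0 = -2 * π ^ 2 * φ 0 := by
  have hI := Jk_int φ hl 0
  unfold Jk
  simp only [pow_zero, mul_one] at hI ⊢
  set f : E4 → ℝ := fun w => ‖w‖ ^ (-(4 : ℝ)) * D1 φ w w with hf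
  have hdim : Module.finrank ℝ E4 = 4 := by simp
  have hmp := (volume : Measure E4).measurePreserving_homeomorphUnitSphereProd
  rw [hdim] at hmp
  have hsym := hmp.symm (Homeomorph.toMeasurableEquiv (homeomorphUnitSphereProd E4))
  have s1 : ∫ w, f w = ∫ w : ({(0)}ᶜ : Set E4), f w.1 ∂((volume : Measure E4).comap (↑)) := by
    rw [integral_subtype_comap (measurableSet_singleton _).compl f,
        restrict_compl_singleton]
  have s2 : ∫ w : ({(0)}ᶜ : Set E4), f w.1 ∂((volume : Measure E4).comap (↑)) =
      ∫ p : Metric.sphere (0 : E4) 1 × Ioi (0 : ℝ), f (p.2.1 • p.1.1)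
        ∂((volume : Measure E4).toSphere.prod (.volumeIoiPow 3)) := by
    have := hsym.integral_comp (MeasurableEquiv.measurableEmbedding _)
      (fun w : ({(0)}ᶜ : Set E4) => f w.1)
    rw [← this]
    refine integral_congr_ae (Eventually.of_forall fun p => ?_)
    simp
  have hI2 : Integrable (fun p : Metric.sphere (0 : E4) 1 × Ioi (0 : ℝ) => f (p.2.1 • p.1.1))
        ((volume : Measure E4).toSphere.prod (.volumeIoiPow 3)) := by
    have h1 : Integrable (fun w : ({(0)}ᶜ : Set E4) => f w.1)
        ((volume : Measure E4).comap (↑)) := by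
      have := (integrableOn_iff_comap_subtypeVal (f := f)
        (measurableSet_singleton (0 : E4)).compl).1 hI.integrableOn
      exact this
    have h2 := hsym.integrable_comp_of_integrable h1
    refine h2.congr (Eventually.of_forall fun p => ?_)
    simp
  have s3 : ∀ ω : Metric.sphere (0 : E4) 1,
      ∫ r : Ioi (0 : ℝ), f (r.1 • ω.1) ∂(.volumeIoiPow 3) = - φ 0 := by
    intro ω
    have hω : ‖ω.1‖ = 1 := by simp
    simp only [Measure.volumeIoiPow, ENNReal.ofReal]
    rw [integral_withDensity_eq_integral_smul,
        integral_subtype_comap measurableSet_Ioi fun a : ℝ ↦ Real.toNNReal (a ^ 3) • f (a • ω.1),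
        setIntegral_congr_fun measurableSet_Ioi (g := fun r => D1 φ (r • ω.1) ω.1)
          fun x hx ↦ ?_, radial_one φ ω.1 hω]
    · have hx : 0 < x := hx
      simp only [NNReal.smul_def]
      rw [Real.coe_toNNReal _ (by positivity)]
      simp only [hf, map_smul, smul_eq_mul, norm_smul, hω, mul_one, Real.norm_of_nonneg hx.le]
      rw [Real.rpow_neg hx.le, show (4 : ℝ) = ((4 : ℕ) : ℝ) by norm_num, Real.rpow_natCast]
      field_simp
    · exact (measurable_subtype_coe.pow_const _).real_toNNReal
  rw [s1, s2, integral_prod _ hI2]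
  simp only [s3, integral_const, Measure.toSphere_real_apply_univ, hdim, smul_eq_mul]
  rw [Measure.real, InnerProductSpace.volume_ball_of_dim_even (k := 2) (by simp), hdim]
  have h2 : (ENNReal.ofReal (π ^ 2 / 2)).toReal = π ^ 2 / 2 :=
    ENNReal.toReal_ofReal (by positivity)
  simp only [ENNReal.ofReal_one, one_pow, one_mul, Nat.factorial]
  norm_num
  rw [h2]
  left
  ring

end jzero

section limit
open Filter Topology

set_option maxSynthPendingDepth 3

/-- Regularised kernel factor. -/
def hs (l s r : ℝ) : ℝ :=
  (l ^ (-(2 * s)) * r ^ (2 * s - 4) - l ^ (-(1 * s)) * r ^ (1 * s - 4)) / s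

/-- Dominating factor. -/
def mm (l r : ℝ) : ℝ :=
  l ^ (-(1 / 4 : ℝ)) * r ^ ((1 / 4 : ℝ) - 4) + l ^ (1 / 4 : ℝ) * r ^ (-(1 / 4 : ℝ) - 4)

lemma mm_ge {r l : ℝ} (hr : 0 < r) (hl : 0 < l) :
    r ^ (-(4 : ℝ)) * Real.exp (|Real.log (r / l)| / 4) ≤ mm l r := by
  have e1 : l ^ (-(1 / 4 : ℝ)) * r ^ ((1 / 4 : ℝ) - 4) =
      r ^ (-(4 : ℝ)) * Real.exp (Real.log (r / l) / 4) := by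
    rw [Real.log_div hr.ne' hl.ne', Real.rpow_def_of_pos hl, Real.rpow_def_of_pos hr,
      Real.rpow_def_of_pos hr, ← Real.exp_add, ← Real.exp_add]
    congr 1; ring
  have e2 : l ^ (1 / 4 : ℝ) * r ^ (-(1 / 4 : ℝ) - 4) =
      r ^ (-(4 : ℝ)) * Real.exp (-Real.log (r / l) / 4) := by
    rw [Real.log_div hr.ne' hl.ne', Real.rpow_def_of_pos hl, Real.rpow_def_of_pos hr,
      Real.rpow_def_of_pos hr, ← Real.exp_add, ← Real.exp_add]
    congr 1; ring
  unfold mm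
  rw [e1, e2, ← mul_add]
  gcongr
  rcases abs_cases (Real.log (r / l)) with ⟨h, _⟩ | ⟨h, _⟩ <;> rw [h]
  · have := Real.exp_pos (-Real.log (r / l) / 4); linarith
  · have := Real.exp_pos (Real.log (r / l) / 4); linarith

lemma hs_eq {r l s : ℝ} (hr : 0 < r) (hl : 0 < l) :
    hs l s r = r ^ (-(4 : ℝ)) *
      ((Real.exp (2 * (s * Real.log (r / l))) - Real.exp (s * Real.log (r / l))) / s) := by
  have e1 : ∀ a : ℝ, l ^ (-(a * s)) * r ^ (a * s - 4) =
      r ^ (-(4 : ℝ)) * Real.exp (a * (s * Real.log (r / l))) := by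
    intro a
    rw [Real.log_div hr.ne' hl.ne', Real.rpow_def_of_pos hl, Real.rpow_def_of_pos hr,
      Real.rpow_def_of_pos hr, ← Real.exp_add, ← Real.exp_add]
    congr 1; ring
  unfold hs
  rw [e1, e1, one_mul]
  ring

lemma hs_bound {r l s : ℝ} (hr : 0 < r) (hl : 0 < l) (h0 : 0 < s) (h1 : s ≤ 1 / 16) :
    |hs l s r| ≤ 8 * mm l r := by
  rw [hs_eq hr hl, abs_mul, abs_of_pos (by positivity : 0 < r ^ (-(4 : ℝ)))]
  set L := Real.log (r / l) with hL
  have hm := mm_ge hr hl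
  rw [← hL] at hm
  have hb : |(Real.exp (2 * (s * L)) - Real.exp (s * L)) / s| ≤ 8 * Real.exp (|L| / 4) := by
    rw [abs_div, abs_of_pos h0, div_le_iff₀ h0]
    have t : ∀ x : ℝ, |Real.exp x - 1| ≤ |x| * Real.exp |x| := by
      intro x
      have h := Complex.norm_exp_sub_sum_le_norm_mul_exp (x : ℂ) 1
      rw [Complex.norm_real, Real.norm_eq_abs] at h
      rw [← Real.norm_eq_abs, ← Complex.norm_real]
      convert h using 3
      · simp
      · simp
    have e : Real.exp (2 * (s * L)) - Real.exp (s * L) =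
        Real.exp (s * L) * (Real.exp (s * L) - 1) := by
      rw [two_mul, Real.exp_add]; ring
    have hLn := abs_nonneg L
    have b1 : Real.exp (s * L) ≤ Real.exp (|L| / 16) := by
      apply Real.exp_le_exp.2
      have := le_abs_self L
      nlinarith
    have b2 : |Real.exp (s * L) - 1| ≤ s * |L| * Real.exp (|L| / 16) := by
      refine (t _).trans ?_
      rw [abs_mul, abs_of_pos h0]
      gcongr
      nlinarith
    have b3 : |L| ≤ 8 * Real.exp (|L| / 8) := by
      have := Real.add_one_le_exp (|L| / 8)
      linarith
    rw [e, abs_mul, Real.abs_exp]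
    calc _ ≤ Real.exp (|L| / 16) * (s * (8 * Real.exp (|L| / 8)) * Real.exp (|L| / 16)) := by
          refine mul_le_mul b1 (b2.trans ?_) (abs_nonneg _) (Real.exp_pos _).le
          gcongr
      _ = 8 * (Real.exp (|L| / 16) * Real.exp (|L| / 8) * Real.exp (|L| / 16)) * s := by ring
      _ = _ := by
          rw [← Real.exp_add, ← Real.exp_add]
          congr 3; ring
  calc _ ≤ r ^ (-(4 : ℝ)) * (8 * Real.exp (|L| / 4)) := by gcongr
    _ = 8 * (r ^ (-(4 : ℝ)) * Real.exp (|L| / 4)) := by ring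
    _ ≤ _ := by gcongr

lemma log_bound {r l : ℝ} (hr : 0 < r) (hl : 0 < l) :
    |r ^ (-(4 : ℝ)) * Real.log (r / l)| ≤ 8 * mm l r := by
  rw [abs_mul, abs_of_pos (by positivity : 0 < r ^ (-(4 : ℝ)))]
  have hm := mm_ge hr hl
  set L := Real.log (r / l) with hL
  have b3 : |L| ≤ 8 * Real.exp (|L| / 4) := by
    have := Real.add_one_le_exp (|L| / 4)
    have := Real.exp_pos (|L| / 4)
    linarith
  calc _ ≤ r ^ (-(4 : ℝ)) * (8 * Real.exp (|L| / 4)) := by gcongr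
    _ = 8 * (r ^ (-(4 : ℝ)) * Real.exp (|L| / 4)) := by ring
    _ ≤ _ := by gcongr

lemma hs_tendsto {r l : ℝ} (hr : 0 < r) (hl : 0 < l) :
    Tendsto (fun s => hs l s r) (𝓝[>] (0 : ℝ)) (𝓝 (r ^ (-(4 : ℝ)) * Real.log (r / l))) := by
  simp_rw [hs_eq hr hl]
  refine Tendsto.const_mul _ ?_
  set L := Real.log (r / l)
  have hd : HasDerivAt (fun s : ℝ => Real.exp (2 * (s * L)) - Real.exp (s * L)) L 0 := by
    have h1 : HasDerivAt (fun s : ℝ => s * L) L 0 := by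
      simpa using (hasDerivAt_id (0 : ℝ)).mul_const L
    have h2 := ((h1.const_mul 2).exp).sub h1.exp
    refine HasDerivAt.congr_deriv h2 ?_
    simp only [zero_mul, mul_zero, Real.exp_zero, one_mul]
    ring
  have := hd.tendsto_slope_zero_right
  simp only [zero_add, zero_mul, mul_zero, sub_self, sub_zero, smul_eq_mul] at this
  refine this.congr fun s => by rw [div_eq_inv_mul]

lemma ae_ne3 : ∀ᵐ q : E4 × E4 × E4, q.1 ≠ 0 ∧ q.2.1 ≠ 0 ∧ q.2.2 ≠ 0 := by
  have h1 : ∀ᵐ q : E4 × E4 × E4, q.1 ≠ 0 :=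
    Measure.quasiMeasurePreserving_fst.ae ae_ne_zero
  have h2 : ∀ᵐ q : E4 × E4 × E4, q.2.1 ≠ 0 :=
    Measure.quasiMeasurePreserving_snd.ae
      (Measure.quasiMeasurePreserving_fst.ae ae_ne_zero : ∀ᵐ q : E4 × E4, q.1 ≠ 0)
  have h3 : ∀ᵐ q : E4 × E4 × E4, q.2.2 ≠ 0 :=
    Measure.quasiMeasurePreserving_snd.ae
      (Measure.quasiMeasurePreserving_snd.ae ae_ne_zero : ∀ᵐ q : E4 × E4, q.2 ≠ 0)
  filter_upwards [h1, h2, h3] with q a b c using ⟨a, b, c⟩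

/-- Abbreviation for the contracted third derivative. -/
def DD (φ : SchwartzMap E4 ℝ) (q : E4 × E4 × E4) : ℝ :=
  D3 φ (q.1 + q.2.1 + q.2.2) q.1 q.2.1 q.2.2

lemma mm_int (φ : SchwartzMap E4 ℝ) (l : ℝ) : Integrable (fun q : E4 × E4 × E4 =>
    mm l ‖q.1‖ * mm l ‖q.2.1‖ * mm l ‖q.2.2‖ * DD φ q) := by
  set A := l ^ (-(1 / 4 : ℝ)) with hA
  set B := l ^ (1 / 4 : ℝ) with hB
  have i : ∀ s t u : ℝ, -1 < s → -1 < t → -1 < u → s + t + u < 1 →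
      Integrable (fun q : E4 × E4 × E4 => K3 s t u q * DD φ q) := fun s t u h1 h2 h3 h4 =>
    int3 (by linarith) (by linarith) (by linarith) h4 φ
  have j1 := (i (1/4) (1/4) (1/4) (by norm_num) (by norm_num) (by norm_num)
    (by norm_num)).const_mul (A * A * A)
  have j2 := (i (1/4) (1/4) (-(1/4)) (by norm_num) (by norm_num) (by norm_num)
    (by norm_num)).const_mul (A * A * B)
  have j3 := (i (1/4) (-(1/4)) (1/4) (by norm_num) (by norm_num) (by norm_num)
    (by norm_num)).const_mul (A * B * A)
  have j4 := (i (1/4) (-(1/4)) (-(1/4)) (by norm_num) (by norm_num) (by norm_num)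
    (by norm_num)).const_mul (A * B * B)
  have j5 := (i (-(1/4)) (1/4) (1/4) (by norm_num) (by norm_num) (by norm_num)
    (by norm_num)).const_mul (B * A * A)
  have j6 := (i (-(1/4)) (1/4) (-(1/4)) (by norm_num) (by norm_num) (by norm_num)
    (by norm_num)).const_mul (B * A * B)
  have j7 := (i (-(1/4)) (-(1/4)) (1/4) (by norm_num) (by norm_num) (by norm_num)
    (by norm_num)).const_mul (B * B * A)
  have j8 := (i (-(1/4)) (-(1/4)) (-(1/4)) (by norm_num) (by norm_num) (by norm_num)
    (by norm_num)).const_mul (B * B * B)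
  refine (((((((j1.fun_add j2).fun_add j3).fun_add j4).fun_add j5).fun_add j6).fun_add
    j7).fun_add j8).congr (Eventually.of_forall fun q => ?_)
  simp only [mm, K3, ← hA, ← hB]
  ring

/-- The regularised integrand. -/
def FF (φ : SchwartzMap E4 ℝ) (l s : ℝ) (q : E4 × E4 × E4) : ℝ :=
  hs l s ‖q.1‖ * hs l s ‖q.2.1‖ * hs l s ‖q.2.2‖ * DD φ q

/-- The limiting integrand. -/
def GG (φ : SchwartzMap E4 ℝ) (l : ℝ) (q : E4 × E4 × E4) : ℝ :=
  (‖q.1‖ ^ (-(4 : ℝ)) * Real.log (‖q.1‖ / l)) * (‖q.2.1‖ ^ (-(4 : ℝ)) * Real.log (‖q.2.1‖ / l)) *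
    (‖q.2.2‖ ^ (-(4 : ℝ)) * Real.log (‖q.2.2‖ / l)) * DD φ q

lemma mm_nonneg {l r : ℝ} (hr : 0 ≤ r) (hl : 0 < l) : 0 ≤ mm l r := by
  unfold mm; positivity

lemma prod_bound {a b c A B C d : ℝ} (ha : |a| ≤ 8 * A) (hb : |b| ≤ 8 * B) (hc : |c| ≤ 8 * C)
    : ‖a * b * c * d‖ ≤ 512 * ‖A * B * C * d‖ := by
  have hA : 0 ≤ A := by have := (abs_nonneg a).trans ha; linarith
  have hB : 0 ≤ B := by have := (abs_nonneg b).trans hb; linarith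
  have hC : 0 ≤ C := by have := (abs_nonneg c).trans hc; linarith
  simp only [norm_mul, Real.norm_of_nonneg hA, Real.norm_of_nonneg hB, Real.norm_of_nonneg hC,
    Real.norm_eq_abs]
  calc _ ≤ (8 * A) * (8 * B) * (8 * C) * |d| := by gcongr
    _ = _ := by ring

lemma DD_meas (φ : SchwartzMap E4 ℝ) : Measurable (DD φ) := D3_meas φ

lemma GG_int (φ : SchwartzMap E4 ℝ) {l : ℝ} (hl : 0 < l) : Integrable (GG φ l) := by
  refine Integrable.mono' ((mm_int φ l).norm.const_mul 512) ?_ ?_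
  · have := DD_meas φ
    have h : Measurable (GG φ l) := by unfold GG; fun_prop
    exact h.aestronglyMeasurable
  · filter_upwards [ae_ne3] with q hq
    exact prod_bound (log_bound (norm_pos_iff.2 hq.1) hl) (log_bound (norm_pos_iff.2 hq.2.1) hl)
      (log_bound (norm_pos_iff.2 hq.2.2) hl)

lemma FF_tendsto (φ : SchwartzMap E4 ℝ) {l : ℝ} (hl : 0 < l) :
    Tendsto (fun s => ∫ q, FF φ l s q) (𝓝[>] (0 : ℝ)) (𝓝 (∫ q, GG φ l q)) := by
  refine tendsto_integral_filter_of_dominated_convergence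
    (fun q => 512 * ‖mm l ‖q.1‖ * mm l ‖q.2.1‖ * mm l ‖q.2.2‖ * DD φ q‖) ?_ ?_
    ((mm_int φ l).norm.const_mul 512) ?_
  · refine Eventually.of_forall fun s => ?_
    have := DD_meas φ
    have h : Measurable (FF φ l s) := by unfold FF hs; fun_prop
    exact h.aestronglyMeasurable
  · have h : ∀ᶠ s in 𝓝[>] (0 : ℝ), s ≤ 1 / 16 := tend0.eventually_le_const (by norm_num)
    filter_upwards [h, self_mem_nhdsWithin] with s h1 h0
    filter_upwards [ae_ne3] with q hq
    exact prod_bound (hs_bound (norm_pos_iff.2 hq.1) hl h0 h1)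
      (hs_bound (norm_pos_iff.2 hq.2.1) hl h0 h1) (hs_bound (norm_pos_iff.2 hq.2.2) hl h0 h1)
  · filter_upwards [ae_ne3] with q hq
    exact (((hs_tendsto (norm_pos_iff.2 hq.1) hl).mul
      (hs_tendsto (norm_pos_iff.2 hq.2.1) hl)).mul
      (hs_tendsto (norm_pos_iff.2 hq.2.2) hl)).mul_const _

/-- The explicit regularised value on a ray. -/
def PP (φ : SchwartzMap E4 ℝ) (l a b c s : ℝ) : ℝ :=
  bb (a * s) (b * s) (c * s) * (l ^ (-((a + b + c) * s)) * Jf φ ((a + b + c) * s))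

lemma PP_int (φ : SchwartzMap E4 ℝ) {l : ℝ} (hl : 0 < l) {a b c s : ℝ} (ha : 0 < a) (hb : 0 < b)
    (hc : 0 < c) (h0 : 0 < s) (h1 : (a + b + c) * s < 1) :
    ∫ q, (l ^ (-(a * s)) * l ^ (-(b * s)) * l ^ (-(c * s))) *
      (K3 (a * s) (b * s) (c * s) q * DD φ q) = 4 * π ^ 4 * PP φ l a b c s := by
  rw [integral_const_mul]
  have := M_val (s := a * s) (t := b * s) (u := c * s) (by positivity) (by positivity)
    (by positivity) (by linarith) φ
  unfold DD PP
  rw [this, ← Real.rpow_add hl, ← Real.rpow_add hl,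
    show a * s + b * s + c * s = (a + b + c) * s by ring,
    show -(a * s) + -(b * s) + -(c * s) = -((a + b + c) * s) by ring]
  ring

lemma PP_integrable (φ : SchwartzMap E4 ℝ) {l : ℝ} {a b c s : ℝ} (ha : 0 < a) (hb : 0 < b)
    (hc : 0 < c) (h0 : 0 < s) (h1 : (a + b + c) * s < 1) :
    Integrable (fun q : E4 × E4 × E4 => (l ^ (-(a * s)) * l ^ (-(b * s)) * l ^ (-(c * s))) *
      (K3 (a * s) (b * s) (c * s) q * DD φ q)) := by
  have qa : 0 < a * s := by positivity
  have qb : 0 < b * s := by positivity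
  have qc : 0 < c * s := by positivity
  exact (int3 (by linarith) (by linarith) (by linarith) (by linarith) φ).const_mul _

/-- The third difference of the regularised values. -/
def TT (φ : SchwartzMap E4 ℝ) (l s : ℝ) : ℝ :=
  PP φ l 2 2 2 s + (-1) * (PP φ l 2 2 1 s + PP φ l 2 1 2 s + PP φ l 1 2 2 s) +
    (PP φ l 2 1 1 s + PP φ l 1 2 1 s + PP φ l 1 1 2 s) + (-1) * PP φ l 1 1 1 s

lemma FF_val (φ : SchwartzMap E4 ℝ) {l : ℝ} (hl : 0 < l) {s : ℝ} (h0 : 0 < s) (h1 : s ≤ 1 / 16) :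
    ∫ q, FF φ l s q = 4 * π ^ 4 * (TT φ l s / s ^ 3) := by
  have v : ∀ a b c : ℝ, 0 < a → 0 < b → 0 < c → a + b + c ≤ 6 →
      ∫ q, (l ^ (-(a * s)) * l ^ (-(b * s)) * l ^ (-(c * s))) *
      (K3 (a * s) (b * s) (c * s) q * DD φ q) = 4 * π ^ 4 * PP φ l a b c s :=
    fun a b c ha hb hc h => PP_int φ hl ha hb hc h0 (by nlinarith)
  have i : ∀ a b c : ℝ, 0 < a → 0 < b → 0 < c → a + b + c ≤ 6 →
      Integrable (fun q : E4 × E4 × E4 => (l ^ (-(a * s)) * l ^ (-(b * s)) * l ^ (-(c * s))) *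
      (K3 (a * s) (b * s) (c * s) q * DD φ q)) :=
    fun a b c ha hb hc h => PP_integrable φ ha hb hc h0 (by nlinarith)
  have i1 := i 2 2 2 (by norm_num) (by norm_num) (by norm_num) (by norm_num)
  have i2 := i 2 2 1 (by norm_num) (by norm_num) (by norm_num) (by norm_num)
  have i3 := i 2 1 2 (by norm_num) (by norm_num) (by norm_num) (by norm_num)
  have i4 := i 1 2 2 (by norm_num) (by norm_num) (by norm_num) (by norm_num)
  have i5 := i 2 1 1 (by norm_num) (by norm_num) (by norm_num) (by norm_num)
  have i6 := i 1 2 1 (by norm_num) (by norm_num) (by norm_num) (by norm_num)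
  have i7 := i 1 1 2 (by norm_num) (by norm_num) (by norm_num) (by norm_num)
  have i8 := i 1 1 1 (by norm_num) (by norm_num) (by norm_num) (by norm_num)
  have e : ∀ q, FF φ l s q = (1 / s ^ 3) * ((((((((
      (l ^ (-(2 * s)) * l ^ (-(2 * s)) * l ^ (-(2 * s))) * (K3 (2 * s) (2 * s) (2 * s) q * DD φ q)
    - (l ^ (-(2 * s)) * l ^ (-(2 * s)) * l ^ (-(1 * s))) * (K3 (2 * s) (2 * s) (1 * s) q * DD φ q))
    - (l ^ (-(2 * s)) * l ^ (-(1 * s)) * l ^ (-(2 * s))) * (K3 (2 * s) (1 * s) (2 * s) q * DD φ q))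
    - (l ^ (-(1 * s)) * l ^ (-(2 * s)) * l ^ (-(2 * s))) * (K3 (1 * s) (2 * s) (2 * s) q * DD φ q))
    + (l ^ (-(2 * s)) * l ^ (-(1 * s)) * l ^ (-(1 * s))) * (K3 (2 * s) (1 * s) (1 * s) q * DD φ q))
    + (l ^ (-(1 * s)) * l ^ (-(2 * s)) * l ^ (-(1 * s))) * (K3 (1 * s) (2 * s) (1 * s) q * DD φ q))
    + (l ^ (-(1 * s)) * l ^ (-(1 * s)) * l ^ (-(2 * s))) * (K3 (1 * s) (1 * s) (2 * s) q * DD φ q))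
    - (l ^ (-(1 * s)) * l ^ (-(1 * s)) * l ^ (-(1 * s))) *
        (K3 (1 * s) (1 * s) (1 * s) q * DD φ q))) := by
    intro q
    simp only [FF, hs, K3]
    generalize ‖q.1‖ ^ (2 * s - 4) = a1
    generalize ‖q.1‖ ^ (1 * s - 4) = a2
    generalize ‖q.2.1‖ ^ (2 * s - 4) = a3
    generalize ‖q.2.1‖ ^ (1 * s - 4) = a4
    generalize ‖q.2.2‖ ^ (2 * s - 4) = a5
    generalize ‖q.2.2‖ ^ (1 * s - 4) = a6
    generalize l ^ (-(2 * s)) = a7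
    generalize l ^ (-(1 * s)) = a8
    field_simp
    ring
  have k2 := i1.sub' i2
  have k3 := k2.sub' i3
  have k4 := k3.sub' i4
  have k5 := k4.fun_add i5
  have k6 := k5.fun_add i6
  have k7 := k6.fun_add i7
  simp only [e]
  rw [integral_const_mul, integral_sub k7 i8, integral_add k6 i7, integral_add k5 i6,
    integral_add k4 i5, integral_sub k3 i4, integral_sub k2 i3, integral_sub i1 i2,
    v 2 2 2 (by norm_num) (by norm_num) (by norm_num) (by norm_num),
    v 2 2 1 (by norm_num) (by norm_num) (by norm_num) (by norm_num),
    v 2 1 2 (by norm_num) (by norm_num) (by norm_num) (by norm_num),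
    v 1 2 2 (by norm_num) (by norm_num) (by norm_num) (by norm_num),
    v 2 1 1 (by norm_num) (by norm_num) (by norm_num) (by norm_num),
    v 1 2 1 (by norm_num) (by norm_num) (by norm_num) (by norm_num),
    v 1 1 2 (by norm_num) (by norm_num) (by norm_num) (by norm_num),
    v 1 1 1 (by norm_num) (by norm_num) (by norm_num) (by norm_num)]
  unfold TT
  ring

lemma TT_ex (φ : SchwartzMap E4 ℝ) {l : ℝ} (hl : 0 < l) :
    Ex3 (TT φ l) 0 0 0 (Jk φ l 3 - 3 / 4 * Jk φ l 1 + (zeta3 / 2 - 1 / 4) * Jk φ l 0) := by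
  have p : ∀ a b c : ℝ, 0 < a → 0 < b → 0 < c → _ := fun a b c ha hb hc =>
    (bb_ex ha hb hc).mul ((JL_ex φ hl).scale (k := a + b + c) (by positivity))
  have h2 : (0 : ℝ) < 2 := by norm_num
  have h1 : (0 : ℝ) < 1 := by norm_num
  have h := (((p 2 2 2 h2 h2 h2).add
    ((((p 2 2 1 h2 h2 h1).add (p 2 1 2 h2 h1 h2)).add (p 1 2 2 h1 h2 h2)).const_mul (-1))).add
    (((p 2 1 1 h2 h1 h1).add (p 1 2 1 h1 h2 h1)).add (p 1 1 2 h1 h1 h2))).add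
    ((p 1 1 1 h1 h1 h1).const_mul (-1))
  have h' : Ex3 (TT φ l) _ _ _ _ := h
  convert h' using 1 <;> ring

lemma main_value (φ : SchwartzMap E4 ℝ) {l : ℝ} (hl : 0 < l) :
    ∫ q, GG φ l q = 4 * π ^ 4 *
      (Jk φ l 3 - 3 / 4 * Jk φ l 1 + (zeta3 / 2 - 1 / 4) * Jk φ l 0) := by
  have t1 := FF_tendsto φ hl
  have t2 := (TT_ex φ hl).tendsto_div.const_mul (4 * π ^ 4)
  refine tendsto_nhds_unique t1 (t2.congr' ?_)
  have h : ∀ᶠ s in 𝓝[>] (0 : ℝ), s ≤ 1 / 16 := tend0.eventually_le_const (by norm_num)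
  filter_upwards [h, self_mem_nhdsWithin] with s h1 h0
  exact (FF_val φ hl h0 h1).symm

end limit

/-- the renormalized trikini (three-bubble chain) amplitude:
`(R_4[r^{-4}])^{*3} = 12π⁴ R_4[r^{-4} log²(r/l)] - 3π⁴ R_4[r^{-4}] + (4ζ(3)-2)π⁶ δ`;
the triple integral below is absolutely convergent. -/
theorem stmt_18 (l : ℝ) (hl : 0 < l) (φ : SchwartzMap (EuclideanSpace ℝ (Fin 4)) ℝ) :
    Integrable (fun q : EuclideanSpace ℝ (Fin 4) × EuclideanSpace ℝ (Fin 4) ×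
        EuclideanSpace ℝ (Fin 4) =>
        ‖q.1‖ ^ (-(4 : ℝ)) * ‖q.2.1‖ ^ (-(4 : ℝ)) * ‖q.2.2‖ ^ (-(4 : ℝ)) *
          Real.log (‖q.1‖ / l) * Real.log (‖q.2.1‖ / l) * Real.log (‖q.2.2‖ / l) *
          ∑ i : Fin 4, ∑ j : Fin 4, ∑ k : Fin 4, q.1 i * q.2.1 j * q.2.2 k *
            thirdDeriv (⇑φ) (q.1 + q.2.1 + q.2.2) (EuclideanSpace.single i 1)
              (EuclideanSpace.single j 1) (EuclideanSpace.single k 1)) ∧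
    -(∫ q : EuclideanSpace ℝ (Fin 4) × EuclideanSpace ℝ (Fin 4) ×
        EuclideanSpace ℝ (Fin 4),
        ‖q.1‖ ^ (-(4 : ℝ)) * ‖q.2.1‖ ^ (-(4 : ℝ)) * ‖q.2.2‖ ^ (-(4 : ℝ)) *
          Real.log (‖q.1‖ / l) * Real.log (‖q.2.1‖ / l) * Real.log (‖q.2.2‖ / l) *
          ∑ i : Fin 4, ∑ j : Fin 4, ∑ k : Fin 4, q.1 i * q.2.1 j * q.2.2 k *
            thirdDeriv (⇑φ) (q.1 + q.2.1 + q.2.2) (EuclideanSpace.single i 1)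
              (EuclideanSpace.single j 1) (EuclideanSpace.single k 1))
      = -4 * Real.pi ^ 4 *
            (∫ w : EuclideanSpace ℝ (Fin 4),
              ‖w‖ ^ (-(4 : ℝ)) * (Real.log (‖w‖ / l)) ^ 3 * fderiv ℝ (⇑φ) w w)
          + 3 * Real.pi ^ 4 *
            (∫ w : EuclideanSpace ℝ (Fin 4),
              ‖w‖ ^ (-(4 : ℝ)) * Real.log (‖w‖ / l) * fderiv ℝ (⇑φ) w w)
          + (4 * zeta3 - 2) * Real.pi ^ 6 * φ 0 := by
  have hG : (fun q : EuclideanSpace ℝ (Fin 4) × EuclideanSpace ℝ (Fin 4) ×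
        EuclideanSpace ℝ (Fin 4) =>
        ‖q.1‖ ^ (-(4 : ℝ)) * ‖q.2.1‖ ^ (-(4 : ℝ)) * ‖q.2.2‖ ^ (-(4 : ℝ)) *
          Real.log (‖q.1‖ / l) * Real.log (‖q.2.1‖ / l) * Real.log (‖q.2.2‖ / l) *
          ∑ i : Fin 4, ∑ j : Fin 4, ∑ k : Fin 4, q.1 i * q.2.1 j * q.2.2 k *
            thirdDeriv (⇑φ) (q.1 + q.2.1 + q.2.2) (EuclideanSpace.single i 1)
              (EuclideanSpace.single j 1) (EuclideanSpace.single k 1)) = GG φ l := by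
    funext q
    rw [sum_eq]
    unfold GG DD
    ring
  have h3 : (∫ w : EuclideanSpace ℝ (Fin 4),
      ‖w‖ ^ (-(4 : ℝ)) * (Real.log (‖w‖ / l)) ^ 3 * fderiv ℝ (⇑φ) w w) = Jk φ l 3 := rfl
  have h1 : (∫ w : EuclideanSpace ℝ (Fin 4),
      ‖w‖ ^ (-(4 : ℝ)) * Real.log (‖w‖ / l) * fderiv ℝ (⇑φ) w w) = Jk φ l 1 := by
    unfold Jk
    simp only [pow_one]
    rfl
  rw [hG, h3, h1]
  refine ⟨GG_int φ hl, ?_⟩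
  rw [main_value φ hl, J0_val φ hl]
  ring

end
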